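/- Let C ⊆ NC°• be a category of noncrossing two-colored partitions in case B. (a) If C is globally colorized and d(C) = 2, then C = ⟨∘^{⊗k}, ∘⊗•, ∘∘⊗••⟩ for k = k(C) ∈ 2ℕ₀; if C is globally colorized and d(C) = 1, then C = ⟨∘^{⊗k}, p₁, ∘⊗•, ∘∘⊗••⟩ for k = k(C) ∈ ℕ₀. (b) If C is locally colorized and K^C(•,•) = ∅, then C = ⟨∘^{⊗k}, p_d, ∘⊗•⟩ for k = k(C) and d = d(C) ∈ ℕ₀; if C is locally colorized and K^C(•,•) ≠ ∅, then C = ⟨∘^{⊗k}, p_d, p′_r, ∘⊗•⟩ for k = k(C) ∈ ℕ₀∖{1}, d = d(C) ∈ ℕ₀∖{1} and r = r(C) ∈ {0, d/2} ∩ ℕ₀ with r ≠ 1, where r(C) := min{t ≥ 1 : t ∈ K^C(•,•)} − 1. -/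

import Mathlib

noncomputable section
namespace CTCP

/-- Colors of points: `true` = white (∘), `false` = black (•). -/
abbrev Color := Bool

def white : Color := true
def black : Color := false

/-- A two-colored partition with `k` upper and `l` lower points.  The block
structure is recorded as a setoid on the disjoint union of the points. -/
structure TCP where
  k : ℕ
  l : ℕ
  upColor : Fin k → Color
  lowColor : Fin l → Color
  rel : Setoid (Fin k ⊕ Fin l)

/-- The disjoint union of two equivalence relations. -/
def sumRel {α β : Type*} (r : Setoid α) (s : Setoid β) : (α ⊕ β) → (α ⊕ β) → Prop
  | .inl a, .inl b => r.r a b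
  | .inr a, .inr b => s.r a b
  | _, _ => False

def sumSetoid {α β : Type*} (r : Setoid α) (s : Setoid β) : Setoid (α ⊕ β) where
  r := sumRel r s
  iseqv := by
    constructor
    · rintro (a | a)
      · exact r.iseqv.refl a
      · exact s.iseqv.refl a
    · rintro (a | a) (b | b) h
      · exact r.iseqv.symm h
      · exact h.elim
      · exact h.elim
      · exact s.iseqv.symm h
    · rintro (a | a) (b | b) (c | c) h₁ h₂
      all_goals first
        | exact r.iseqv.trans h₁ h₂
        | exact s.iseqv.trans h₁ h₂
        | exact h₁.elim
        | exact h₂.elim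

def splitPt (p q : TCP) :
    (Fin (p.k + q.k) ⊕ Fin (p.l + q.l)) → ((Fin p.k ⊕ Fin p.l) ⊕ (Fin q.k ⊕ Fin q.l))
  | .inl i => (finSumFinEquiv.symm i).elim (fun a => .inl (.inl a)) (fun b => .inr (.inl b))
  | .inr j => (finSumFinEquiv.symm j).elim (fun a => .inl (.inr a)) (fun b => .inr (.inr b))

/-- Tensor product (horizontal concatenation) of two-colored partitions. -/
def tensor (p q : TCP) : TCP where
  k := p.k + q.k
  l := p.l + q.l
  upColor := fun i => (finSumFinEquiv.symm i).elim p.upColor q.upColor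
  lowColor := fun j => (finSumFinEquiv.symm j).elim p.lowColor q.lowColor
  rel := Setoid.comap (splitPt p q) (sumSetoid p.rel q.rel)

def compEmbMid (q p : TCP) (h : q.l = p.k) :
    (Fin p.k ⊕ Fin p.l) → ((Fin q.k ⊕ Fin q.l) ⊕ Fin p.l)
  | .inl i => .inl (.inr (Fin.cast h.symm i))
  | .inr j => .inr j

/-- The relation generating the blocks of the composition of `q` and `p`:
the blocks of `q` together with the blocks of `p`, glued along the middle row. -/
def compRel (q p : TCP) (h : q.l = p.k) :
    ((Fin q.k ⊕ Fin q.l) ⊕ Fin p.l) → ((Fin q.k ⊕ Fin q.l) ⊕ Fin p.l) → Prop :=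
  fun t t' =>
    (∃ x y, q.rel.r x y ∧ t = .inl x ∧ t' = .inl y) ∨
    (∃ x y, p.rel.r x y ∧ t = compEmbMid q p h x ∧ t' = compEmbMid q p h y)

/-- Composition (vertical concatenation) of `q ∈ P(k,l)` with `p ∈ P(l,m)`:
blocks are joined through the middle points, which are then deleted. -/
def comp (q p : TCP) (h : q.l = p.k) : TCP where
  k := q.k
  l := p.l
  upColor := q.upColor
  lowColor := p.lowColor
  rel := Setoid.comap
    (Sum.elim (fun i : Fin q.k => (Sum.inl (Sum.inl i) : (Fin q.k ⊕ Fin q.l) ⊕ Fin p.l))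
      (fun j : Fin p.l => Sum.inr j))
    (Relation.EqvGen.setoid (compRel q p h))

/-- The colors of the lower row of `q` match the colors of the upper row of `p`. -/
def ColorsMatch (q p : TCP) (h : q.l = p.k) : Prop :=
  ∀ j : Fin q.l, q.lowColor j = p.upColor (Fin.cast h j)

/-- Involution: reflection at the horizontal axis. -/
def invol (p : TCP) : TCP where
  k := p.l
  l := p.k
  upColor := p.lowColor
  lowColor := p.upColor
  rel := Setoid.comap Sum.swap p.rel

/-- Vertical reflection: reflection at the vertical axis. -/
def vref (p : TCP) : TCP where
  k := p.k
  l := p.l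
  upColor := fun i => p.upColor i.rev
  lowColor := fun j => p.lowColor j.rev
  rel := Setoid.comap (Sum.map Fin.rev Fin.rev) p.rel

/-- Inversion of colors. -/
def cinv (p : TCP) : TCP where
  k := p.k
  l := p.l
  upColor := fun i => !(p.upColor i)
  lowColor := fun j => !(p.lowColor j)
  rel := p.rel

/-- Verticolor reflection `p̃`: vertical reflection combined with color inversion. -/
def vcref (p : TCP) : TCP := cinv (vref p)

/-- Rotation of the leftmost upper point to the left end of the lower row
(inverting its color). -/
def rotULdown (p : TCP) (h : 0 < p.k) : TCP where
  k := p.k - 1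
  l := p.l + 1
  upColor := fun i => p.upColor ⟨i.1 + 1, by have := i.2; omega⟩
  lowColor := fun j =>
    if hj : j.1 = 0 then !(p.upColor ⟨0, h⟩)
    else p.lowColor ⟨j.1 - 1, by have := j.2; omega⟩
  rel := Setoid.comap
    (Sum.elim
      (fun i : Fin (p.k - 1) => (Sum.inl ⟨i.1 + 1, by have := i.2; omega⟩ : Fin p.k ⊕ Fin p.l))
      (fun j : Fin (p.l + 1) =>
        if hj : j.1 = 0 then Sum.inl ⟨0, h⟩
        else Sum.inr ⟨j.1 - 1, by have := j.2; omega⟩))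
    p.rel

/-- Rotation of the rightmost upper point to the right end of the lower row
(inverting its color). -/
def rotURdown (p : TCP) (h : 0 < p.k) : TCP where
  k := p.k - 1
  l := p.l + 1
  upColor := fun i => p.upColor ⟨i.1, by have := i.2; omega⟩
  lowColor := fun j =>
    if hj : j.1 < p.l then p.lowColor ⟨j.1, hj⟩
    else !(p.upColor ⟨p.k - 1, by omega⟩)
  rel := Setoid.comap
    (Sum.elim
      (fun i : Fin (p.k - 1) => (Sum.inl ⟨i.1, by have := i.2; omega⟩ : Fin p.k ⊕ Fin p.l))
      (fun j : Fin (p.l + 1) =>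
        if hj : j.1 < p.l then Sum.inr ⟨j.1, hj⟩
        else Sum.inl ⟨p.k - 1, by omega⟩))
    p.rel

/-- Rotation of the leftmost lower point to the left end of the upper row
(inverting its color). -/
def rotULup (p : TCP) (h : 0 < p.l) : TCP where
  k := p.k + 1
  l := p.l - 1
  upColor := fun i =>
    if hi : i.1 = 0 then !(p.lowColor ⟨0, h⟩)
    else p.upColor ⟨i.1 - 1, by have := i.2; omega⟩
  lowColor := fun j => p.lowColor ⟨j.1 + 1, by have := j.2; omega⟩
  rel := Setoid.comap
    (Sum.elim
      (fun i : Fin (p.k + 1) =>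
        if hi : i.1 = 0 then (Sum.inr ⟨0, h⟩ : Fin p.k ⊕ Fin p.l)
        else Sum.inl ⟨i.1 - 1, by have := i.2; omega⟩)
      (fun j : Fin (p.l - 1) => Sum.inr ⟨j.1 + 1, by have := j.2; omega⟩))
    p.rel

/-- Rotation of the rightmost lower point to the right end of the upper row
(inverting its color). -/
def rotURup (p : TCP) (h : 0 < p.l) : TCP where
  k := p.k + 1
  l := p.l - 1
  upColor := fun i =>
    if hi : i.1 < p.k then p.upColor ⟨i.1, hi⟩
    else !(p.lowColor ⟨p.l - 1, by omega⟩)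
  lowColor := fun j => p.lowColor ⟨j.1, by have := j.2; omega⟩
  rel := Setoid.comap
    (Sum.elim
      (fun i : Fin (p.k + 1) =>
        if hi : i.1 < p.k then (Sum.inl ⟨i.1, hi⟩ : Fin p.k ⊕ Fin p.l)
        else Sum.inr ⟨p.l - 1, by omega⟩)
      (fun j : Fin (p.l - 1) => Sum.inr ⟨j.1, by have := j.2; omega⟩))
    p.rel

/-- `p'` is obtained from `p` by rotating an outermost point of one row to the
corresponding end of the other row, inverting its color. -/
def IsRotationOf (p' p : TCP) : Prop :=
  (∃ h : 0 < p.k, p' = rotULdown p h) ∨ (∃ h : 0 < p.k, p' = rotURdown p h) ∨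
  (∃ h : 0 < p.l, p' = rotULup p h) ∨ (∃ h : 0 < p.l, p' = rotURup p h)

/-- A partition with no upper points, given by colors and block labels. -/
def mkLower (n : ℕ) (color : Fin n → Color) (lbl : Fin n → ℕ) : TCP where
  k := 0
  l := n
  upColor := Fin.elim0
  lowColor := color
  rel := Setoid.ker (Sum.elim Fin.elim0 lbl)

/-- The identity partition of color `c`. -/
def idPart (c : Color) : TCP where
  k := 1
  l := 1
  upColor := fun _ => c
  lowColor := fun _ => c
  rel := ⊤

/-- The pair partition on two lower points of colors `c₁`, `c₂`. -/
def pairLower (c₁ c₂ : Color) : TCP := mkLower 2 ![c₁, c₂] (fun _ => 0)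

/-- The singleton of color `c`. -/
def singl (c : Color) : TCP := mkLower 1 (fun _ => c) (fun _ => 0)

/-- `bPart s` : one block on `s` white lower points (`bPart 0` is the empty partition). -/
def bPart (s : ℕ) : TCP := mkLower s (fun _ => white) (fun _ => 0)

/-- One block on four lower points with the given colors. -/
def fourBlock (c₁ c₂ c₃ c₄ : Color) : TCP := mkLower 4 ![c₁, c₂, c₃, c₄] (fun _ => 0)

/-- The four-block ∘•∘•. -/
def fourWBWB : TCP := fourBlock white black white black

/-- The four-block ∘∘••. -/
def fourWWBB : TCP := fourBlock white white black black

/-- The empty partition. -/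
def emptyPart : TCP := mkLower 0 Fin.elim0 Fin.elim0

/-- The partition ∘⊗• (a white and a black singleton). -/
def singPair : TCP := tensor (singl white) (singl black)

/-- The partition ∘∘⊗••. -/
def wwbb : TCP := tensor (pairLower white white) (pairLower black black)

/-- The crossing partition `X` on four white points: first upper point connected to the
second lower point, second upper point connected to the first lower point. -/
def crossPart : TCP where
  k := 2
  l := 2
  upColor := fun _ => white
  lowColor := fun _ => white
  rel := Setoid.ker (Sum.elim (fun i : Fin 2 => (i.1 : ℕ)) (fun j : Fin 2 => 1 - j.1))

/-- `n`-fold tensor power. -/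
def tensorPow (p : TCP) : ℕ → TCP
  | 0 => emptyPart
  | n + 1 => tensor (tensorPow p n) p

/-- The partition `p_d`: from left to right, `d` white singletons, a white point, `d` black
singletons and a black point, the two non-singleton points forming a pair block. -/
def pPart (d : ℕ) : TCP :=
  mkLower (2 * d + 2) (fun j => decide (j.1 ≤ d))
    (fun j => if j.1 = d ∨ j.1 = 2 * d + 1 then 0 else j.1 + 1)

/-- The partition `p′_r`: from left to right, `r+1` white singletons, a black point, `r−1`
black singletons and a black point, the black non-singleton points forming a pair block;
for `r = 0` the middle consists of one white singleton instead. -/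
def pPrime (r : ℕ) : TCP :=
  if r = 0 then
    mkLower 4 ![white, black, white, black]
      (fun j => if j.1 = 1 ∨ j.1 = 3 then 0 else j.1 + 1)
  else
    mkLower (2 * r + 2) (fun j => decide (j.1 ≤ r))
      (fun j => if j.1 = r + 1 ∨ j.1 = 2 * r + 1 then 0 else j.1 + 1)

/-- A category of two-colored partitions: a class of two-colored partitions closed under
tensor products, composition (when defined) and involution, containing both bicolored
pair partitions and both identity partitions. -/
structure IsCategory (C : Set TCP) : Prop where
  tensor_mem : ∀ p ∈ C, ∀ q ∈ C, tensor p q ∈ C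
  comp_mem : ∀ q ∈ C, ∀ p ∈ C, ∀ h : q.l = p.k, ColorsMatch q p h → comp q p h ∈ C
  invol_mem : ∀ p ∈ C, invol p ∈ C
  idw_mem : idPart white ∈ C
  idb_mem : idPart black ∈ C
  pairwb_mem : pairLower white black ∈ C
  pairbw_mem : pairLower black white ∈ C

/-- The smallest category of partitions containing `S`. -/
def generated (S : Set TCP) : Set TCP :=
  {p | ∀ C : Set TCP, IsCategory C → S ⊆ C → p ∈ C}

/-- `c(p)` : (white lower points + black upper points) − (black lower points + white upper
points). -/
def cval (p : TCP) : ℤ :=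
  ((Nat.card {j : Fin p.l // p.lowColor j = white} +
      Nat.card {i : Fin p.k // p.upColor i = black} : ℕ) : ℤ) -
    ((Nat.card {j : Fin p.l // p.lowColor j = black} +
      Nat.card {i : Fin p.k // p.upColor i = white} : ℕ) : ℤ)

/-- Position of a point on the line obtained by rotating all upper points down to the
left of the lower row. -/
def linePos (p : TCP) : (Fin p.k ⊕ Fin p.l) → ℕ :=
  Sum.elim (fun i => p.k - 1 - i.1) (fun j => p.k + j.1)

/-- A partition is noncrossing if its strings can be drawn without crossings. -/
def Noncrossing (p : TCP) : Prop :=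
  ∀ a b x y : Fin p.k ⊕ Fin p.l,
    linePos p a < linePos p b → linePos p b < linePos p x → linePos p x < linePos p y →
    p.rel.r a x → p.rel.r b y → p.rel.r a b

/-- The number of points in the block of the point `x`. -/
def blockSize (p : TCP) (x : Fin p.k ⊕ Fin p.l) : ℕ := Nat.card {y // p.rel.r x y}

/-- The partition obtained from `p` by rotating all upper points down, so that it has no
upper points. -/
def toLine (p : TCP) : TCP where
  k := 0
  l := p.k + p.l
  upColor := Fin.elim0
  lowColor := fun j =>
    if hj : j.1 < p.k then !(p.upColor ⟨p.k - 1 - j.1, by omega⟩)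
    else p.lowColor ⟨j.1 - p.k, by have := j.2; omega⟩
  rel := Setoid.comap
    (Sum.elim (fun i : Fin 0 => (Fin.elim0 i : Fin p.k ⊕ Fin p.l))
      (fun j : Fin (p.k + p.l) =>
        if hj : j.1 < p.k then Sum.inl ⟨p.k - 1 - j.1, by omega⟩
        else Sum.inr ⟨j.1 - p.k, by have := j.2; omega⟩))
    p.rel

def eraseLowRel (p : TCP) (j : ℕ) (hj : j + 1 < p.l) :
    (Fin p.k ⊕ Fin p.l) → (Fin p.k ⊕ Fin p.l) → Prop :=
  fun x y => p.rel.r x y ∨ (x = Sum.inr ⟨j, by omega⟩ ∧ y = Sum.inr ⟨j + 1, hj⟩)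

/-- Erasing the `j`-th and `(j+1)`-th lower points of `p`, first joining their blocks. -/
def eraseLowerPair (p : TCP) (j : ℕ) (hj : j + 1 < p.l) : TCP where
  k := p.k
  l := p.l - 2
  upColor := p.upColor
  lowColor := fun m =>
    if hm : m.1 < j then p.lowColor ⟨m.1, by omega⟩
    else p.lowColor ⟨m.1 + 2, by have := m.2; omega⟩
  rel := Setoid.comap
    (Sum.elim (fun i : Fin p.k => (Sum.inl i : Fin p.k ⊕ Fin p.l))
      (fun m : Fin (p.l - 2) =>
        if hm : m.1 < j then Sum.inr ⟨m.1, by omega⟩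
        else Sum.inr ⟨m.1 + 2, by have := m.2; omega⟩))
    (Relation.EqvGen.setoid (eraseLowRel p j hj))

def eraseUpRel (p : TCP) (j : ℕ) (hj : j + 1 < p.k) :
    (Fin p.k ⊕ Fin p.l) → (Fin p.k ⊕ Fin p.l) → Prop :=
  fun x y => p.rel.r x y ∨ (x = Sum.inl ⟨j, by omega⟩ ∧ y = Sum.inl ⟨j + 1, hj⟩)

/-- Erasing the `j`-th and `(j+1)`-th upper points of `p`, first joining their blocks. -/
def eraseUpperPair (p : TCP) (j : ℕ) (hj : j + 1 < p.k) : TCP where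
  k := p.k - 2
  l := p.l
  upColor := fun m =>
    if hm : m.1 < j then p.upColor ⟨m.1, by omega⟩
    else p.upColor ⟨m.1 + 2, by have := m.2; omega⟩
  lowColor := p.lowColor
  rel := Setoid.comap
    (Sum.elim
      (fun m : Fin (p.k - 2) =>
        if hm : m.1 < j then (Sum.inl ⟨m.1, by omega⟩ : Fin p.k ⊕ Fin p.l)
        else Sum.inl ⟨m.1 + 2, by have := m.2; omega⟩)
      (fun i : Fin p.l => Sum.inr i))
    (Relation.EqvGen.setoid (eraseUpRel p j hj))

/-- `p₁ ⊗ p₂ ∈ C` is in nest decomposed form, with the first point of `p₂` colored `x`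
and the last point of `p₂` colored `y` (and those two points in the same block). -/
def InNDF (C : Set TCP) (x y : Color) (p₁ p₂ : TCP) : Prop :=
  tensor p₁ p₂ ∈ C ∧ Noncrossing (tensor p₁ p₂) ∧ p₁.k = 0 ∧ p₂.k = 0 ∧ 0 < p₁.l ∧
    ∃ h : 2 ≤ p₂.l,
      p₂.lowColor ⟨0, by omega⟩ = x ∧ p₂.lowColor ⟨p₂.l - 1, by omega⟩ = y ∧
      p₂.rel.r (Sum.inr ⟨0, by omega⟩) (Sum.inr ⟨p₂.l - 1, by omega⟩)

/-- `K^C(x,y)`: the set of values `c(p₁)` over nest decomposed forms `p₁ ⊗ p₂ ∈ C` whose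
outer block starts with color `x` and ends with color `y`. -/
def Kset (C : Set TCP) (x y : Color) : Set ℤ :=
  {n | ∃ p₁ p₂, InNDF C x y p₁ p₂ ∧ cval p₁ = n}

/-- The degree of reflection `k(C)`. -/
def kdeg (C : Set TCP) : ℕ := sInf {n : ℕ | 0 < n ∧ ∃ p ∈ C, cval p = (n : ℤ)}

/-- The local parameter `d(C)`. -/
def ddeg (C : Set TCP) : ℕ := sInf {n : ℕ | 0 < n ∧ (n : ℤ) ∈ Kset C white black}

/-- The local parameter `r(C) = min {t ≥ 1 | t ∈ K^C(•,•)} − 1`. -/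
def rdeg (C : Set TCP) : ℕ := sInf {t : ℕ | 1 ≤ t ∧ (t : ℤ) ∈ Kset C black black} - 1

/-- `C` is globally colorized if it contains `∘∘ ⊗ ••`. -/
def GloballyColorized (C : Set TCP) : Prop := wwbb ∈ C

def CaseO (C : Set TCP) : Prop := singPair ∉ C ∧ fourWBWB ∉ C
def CaseB (C : Set TCP) : Prop := singPair ∈ C ∧ fourWBWB ∉ C
def CaseH (C : Set TCP) : Prop := singPair ∉ C ∧ fourWBWB ∈ C
def CaseS (C : Set TCP) : Prop := singPair ∈ C ∧ fourWBWB ∈ C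

/-! Non-colored partitions. -/

/-- A non-colored partition with `k` upper and `l` lower points. -/
structure NCP where
  k : ℕ
  l : ℕ
  rel : Setoid (Fin k ⊕ Fin l)

namespace NCP

def splitPt (p q : NCP) :
    (Fin (p.k + q.k) ⊕ Fin (p.l + q.l)) → ((Fin p.k ⊕ Fin p.l) ⊕ (Fin q.k ⊕ Fin q.l))
  | .inl i => (finSumFinEquiv.symm i).elim (fun a => .inl (.inl a)) (fun b => .inr (.inl b))
  | .inr j => (finSumFinEquiv.symm j).elim (fun a => .inl (.inr a)) (fun b => .inr (.inr b))

def tensor (p q : NCP) : NCP where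
  k := p.k + q.k
  l := p.l + q.l
  rel := Setoid.comap (splitPt p q) (sumSetoid p.rel q.rel)

def compEmbMid (q p : NCP) (h : q.l = p.k) :
    (Fin p.k ⊕ Fin p.l) → ((Fin q.k ⊕ Fin q.l) ⊕ Fin p.l)
  | .inl i => .inl (.inr (Fin.cast h.symm i))
  | .inr j => .inr j

def compRel (q p : NCP) (h : q.l = p.k) :
    ((Fin q.k ⊕ Fin q.l) ⊕ Fin p.l) → ((Fin q.k ⊕ Fin q.l) ⊕ Fin p.l) → Prop :=
  fun t t' =>
    (∃ x y, q.rel.r x y ∧ t = .inl x ∧ t' = .inl y) ∨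
    (∃ x y, p.rel.r x y ∧ t = compEmbMid q p h x ∧ t' = compEmbMid q p h y)

def comp (q p : NCP) (h : q.l = p.k) : NCP where
  k := q.k
  l := p.l
  rel := Setoid.comap
    (Sum.elim (fun i : Fin q.k => (Sum.inl (Sum.inl i) : (Fin q.k ⊕ Fin q.l) ⊕ Fin p.l))
      (fun j : Fin p.l => Sum.inr j))
    (Relation.EqvGen.setoid (compRel q p h))

def invol (p : NCP) : NCP where
  k := p.l
  l := p.k
  rel := Setoid.comap Sum.swap p.rel

/-- The non-colored identity partition. -/
def idN : NCP := ⟨1, 1, ⊤⟩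

/-- The non-colored pair partition on two lower points. -/
def pairN : NCP := ⟨0, 2, ⊤⟩

end NCP

/-- A category of non-colored partitions. -/
structure IsCategoryN (D : Set NCP) : Prop where
  tensor_mem : ∀ p ∈ D, ∀ q ∈ D, NCP.tensor p q ∈ D
  comp_mem : ∀ q ∈ D, ∀ p ∈ D, ∀ h : q.l = p.k, NCP.comp q p h ∈ D
  invol_mem : ∀ p ∈ D, NCP.invol p ∈ D
  id_mem : NCP.idN ∈ D
  pair_mem : NCP.pairN ∈ D

/-- The map `Ψ` forgetting the colors of a two-colored partition. -/
def forget (p : TCP) : NCP := ⟨p.k, p.l, p.rel⟩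

/-! ### Relational semantics of partitions -/

/-- The color word of the upper row. -/
def upWord (p : TCP) : List Color := List.ofFn p.upColor

/-- The color word of the lower row. -/
def lowWord (p : TCP) : List Color := List.ofFn p.lowColor

/-- A Boolean labelling of the points which is constant on the blocks of `p`. -/
def Compat (p : TCP) (f : Fin p.k → Bool) (g : Fin p.l → Bool) : Prop :=
  ∀ x y, p.rel.r x y → Sum.elim f g x = Sum.elim f g y

/-- The relation between Boolean labellings of the upper and of the lower row given by `p`. -/
def sem (p : TCP) (a b : List Bool) : Prop :=
  ∃ f g, a = List.ofFn f ∧ b = List.ofFn g ∧ Compat p f g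

theorem sem_ofFn {p : TCP} {f : Fin p.k → Bool} {g : Fin p.l → Bool} :
    sem p (List.ofFn f) (List.ofFn g) ↔ Compat p f g := by
  constructor
  · rintro ⟨f', g', hf, hg, h⟩
    rw [List.ofFn_inj] at hf hg
    subst hf hg
    exact h
  · exact fun h => ⟨f, g, rfl, rfl, h⟩

theorem sem.length_up {p : TCP} {a b : List Bool} (h : sem p a b) :
    a.length = (upWord p).length := by
  obtain ⟨f, g, rfl, rfl, -⟩ := h
  simp [upWord]

theorem sem.length_low {p : TCP} {a b : List Bool} (h : sem p a b) :
    b.length = (lowWord p).length := by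
  obtain ⟨f, g, rfl, rfl, -⟩ := h
  simp [lowWord]

theorem exists_compat_separating (p : TCP) (x y : Fin p.k ⊕ Fin p.l) (h : ¬ p.rel.r x y) :
    ∃ f g, Compat p f g ∧ Sum.elim f g x ≠ Sum.elim f g y := by
  classical
  refine ⟨fun i => decide (p.rel.r x (.inl i)), fun j => decide (p.rel.r x (.inr j)), ?_, ?_⟩
  · have key : ∀ z, Sum.elim (fun i => decide (p.rel.r x (.inl i)))
        (fun j => decide (p.rel.r x (.inr j))) z = decide (p.rel.r x z) := by
      rintro (z | z) <;> rfl
    intro u v huv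
    rw [key, key, decide_eq_decide]
    exact ⟨fun hu => p.rel.iseqv.trans hu huv,
      fun hv => p.rel.iseqv.trans hv (p.rel.iseqv.symm huv)⟩
  · have key : ∀ z, Sum.elim (fun i => decide (p.rel.r x (.inl i)))
        (fun j => decide (p.rel.r x (.inr j))) z = decide (p.rel.r x z) := by
      rintro (z | z) <;> rfl
    rw [key, key, ne_eq, decide_eq_decide]
    exact fun hh => h (hh.1 (p.rel.iseqv.refl x))

theorem rel_iff_compat (p : TCP) (x y : Fin p.k ⊕ Fin p.l) :
    p.rel.r x y ↔ ∀ f g, Compat p f g → Sum.elim f g x = Sum.elim f g y := by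
  refine ⟨fun h f g hfg => hfg x y h, fun h => ?_⟩
  by_contra hn
  obtain ⟨f, g, hc, hne⟩ := exists_compat_separating p x y hn
  exact hne (h f g hc)

/-- A partition is determined by its color words and its relation on labellings. -/
theorem eq_of_sem {p q : TCP} (hu : upWord p = upWord q) (hl : lowWord p = lowWord q)
    (hs : ∀ a b, sem p a b ↔ sem q a b) : p = q := by
  obtain ⟨k, l, u, v, r⟩ := p
  obtain ⟨k', l', u', v', r'⟩ := q
  have hk : k = k' := by simpa [upWord] using congrArg List.length hu
  have hl' : l = l' := by simpa [lowWord] using congrArg List.length hl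
  subst hk hl'
  have hu' : u = u' := List.ofFn_inj.1 hu
  have hv' : v = v' := List.ofFn_inj.1 hl
  subst hu' hv'
  have hr : r = r' := by
    ext x y
    have h1 := rel_iff_compat ⟨k, l, u, v, r⟩ x y
    have h2 := rel_iff_compat ⟨k, l, u, v, r'⟩ x y
    refine h1.trans (Iff.trans ?_ h2.symm)
    refine forall_congr' fun f => forall_congr' fun g => ?_
    have h3 := hs (List.ofFn f) (List.ofFn g)
    rw [sem_ofFn (p := ⟨k, l, u, v, r⟩), sem_ofFn (p := ⟨k, l, u, v, r'⟩)] at h3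
    rw [h3]
  subst hr
  rfl

theorem upWord_tensor (p q : TCP) : upWord (tensor p q) = upWord p ++ upWord q := by
  unfold upWord
  rw [← List.ofFn_fin_append]
  congr 1
  funext i
  refine Fin.addCases (fun i => ?_) (fun i => ?_) i <;> simp [tensor]

theorem lowWord_tensor (p q : TCP) : lowWord (tensor p q) = lowWord p ++ lowWord q := by
  unfold lowWord
  rw [← List.ofFn_fin_append]
  congr 1
  funext i
  refine Fin.addCases (fun i => ?_) (fun i => ?_) i <;> simp [tensor]

theorem compat_tensor {p q : TCP} {f₁ : Fin p.k → Bool} {f₂ : Fin q.k → Bool}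
    {g₁ : Fin p.l → Bool} {g₂ : Fin q.l → Bool} :
    Compat (tensor p q) (Fin.append f₁ f₂) (Fin.append g₁ g₂) ↔
      Compat p f₁ g₁ ∧ Compat q f₂ g₂ := by
  have hsplit : ∀ x, Sum.elim (Fin.append f₁ f₂) (Fin.append g₁ g₂) x =
      Sum.elim (Sum.elim f₁ g₁) (Sum.elim f₂ g₂) (splitPt p q x) := by
    rintro (x | x) <;> refine Fin.addCases (fun i => ?_) (fun i => ?_) x <;> simp [splitPt]
  constructor
  · intro h
    constructor
    · intro x y hxy
      let e : Fin p.k ⊕ Fin p.l → Fin (p.k + q.k) ⊕ Fin (p.l + q.l) :=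
        Sum.map (Fin.castAdd q.k) (Fin.castAdd q.l)
      have he : ∀ z, splitPt p q (e z) = .inl z := by
        rintro (z | z) <;> simp [e, splitPt]
      have := h (e x) (e y) (by
        change sumRel _ _ (splitPt p q (e x)) (splitPt p q (e y))
        rw [he, he]; exact hxy)
      have h1 := hsplit (e x)
      have h2 := hsplit (e y)
      rw [he] at h1 h2
      exact h1.symm.trans (this.trans h2)
    · intro x y hxy
      let e : Fin q.k ⊕ Fin q.l → Fin (p.k + q.k) ⊕ Fin (p.l + q.l) :=
        Sum.map (Fin.natAdd p.k) (Fin.natAdd p.l)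
      have he : ∀ z, splitPt p q (e z) = .inr z := by
        rintro (z | z) <;> simp [e, splitPt]
      have := h (e x) (e y) (by
        change sumRel _ _ (splitPt p q (e x)) (splitPt p q (e y))
        rw [he, he]; exact hxy)
      have h1 := hsplit (e x)
      have h2 := hsplit (e y)
      rw [he] at h1 h2
      exact h1.symm.trans (this.trans h2)
  · rintro ⟨h1, h2⟩ x y hxy
    change sumRel _ _ (splitPt p q x) (splitPt p q y) at hxy
    refine (hsplit x).trans (Eq.trans ?_ (hsplit y).symm)
    rcases hx : splitPt p q x with u | u <;> rcases hy : splitPt p q y with v | v <;>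
      rw [hx, hy] at hxy
    · exact h1 u v hxy
    · exact hxy.elim
    · exact hxy.elim
    · exact h2 u v hxy

theorem sem_tensor (p q : TCP) (a b : List Bool) :
    sem (tensor p q) a b ↔
      ∃ a₁ a₂ b₁ b₂, a = a₁ ++ a₂ ∧ b = b₁ ++ b₂ ∧ sem p a₁ b₁ ∧ sem q a₂ b₂ := by
  constructor
  · rintro ⟨f, g, rfl, rfl, h⟩
    have hf : f = Fin.append (fun i => f (Fin.castAdd _ i)) (fun i => f (Fin.natAdd _ i)) :=
      (Fin.append_castAdd_natAdd (f := f)).symm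
    have hg : g = Fin.append (fun i => g (Fin.castAdd _ i)) (fun i => g (Fin.natAdd _ i)) :=
      (Fin.append_castAdd_natAdd (f := g)).symm
    rw [hf, hg] at h
    obtain ⟨h1, h2⟩ := compat_tensor.1 h
    refine ⟨_, _, _, _, ?_, ?_, ⟨_, _, rfl, rfl, h1⟩, ⟨_, _, rfl, rfl, h2⟩⟩
    · rw [← List.ofFn_fin_append, ← hf]; rfl
    · rw [← List.ofFn_fin_append, ← hg]; rfl
  · rintro ⟨_, _, _, _, rfl, rfl, ⟨f₁, g₁, rfl, rfl, h1⟩, ⟨f₂, g₂, rfl, rfl, h2⟩⟩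
    exact ⟨Fin.append f₁ f₂, Fin.append g₁ g₂, (List.ofFn_fin_append _ _).symm,
      (List.ofFn_fin_append _ _).symm, compat_tensor.2 ⟨h1, h2⟩⟩

theorem eqvGen_apply_eq {α β : Type*} {r : α → α → Prop} {φ : α → β}
    (h : ∀ x y, r x y → φ x = φ y) {x y : α} (hxy : Relation.EqvGen r x y) : φ x = φ y := by
  induction hxy with
  | rel x y hr => exact h x y hr
  | refl x => rfl
  | symm x y _ ih => exact ih.symm
  | trans x y z _ _ ih1 ih2 => exact ih1.trans ih2

theorem sem_comp (q p : TCP) (h : q.l = p.k) (a c : List Bool) :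
    sem (comp q p h) a c ↔ ∃ b, sem q a b ∧ sem p b c := by
  classical
  obtain ⟨k, l, u, v, r⟩ := q
  obtain ⟨l', m, u', v', r'⟩ := p
  dsimp only at h
  subst h
  set q : TCP := ⟨k, l, u, v, r⟩ with hq
  set p : TCP := ⟨l, m, u', v', r'⟩ with hp
  constructor
  · rintro ⟨f, g, rfl, rfl, hfg⟩
    change Fin k → Bool at f
    change Fin m → Bool at g
    let bd : Fin k ⊕ Fin m → (Fin k ⊕ Fin l) ⊕ Fin m :=
      Sum.elim (fun i => .inl (.inl i)) (fun j => .inr j)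
    let φ : (Fin k ⊕ Fin l) ⊕ Fin m → Bool := fun t =>
      decide (∃ x, Relation.EqvGen (compRel q p rfl) t (bd x) ∧ Sum.elim f g x = true)
    have hφ : ∀ s t, compRel q p rfl s t → φ s = φ t := by
      intro s t hst
      simp only [φ, decide_eq_decide]
      constructor
      · rintro ⟨x, hx, hx'⟩
        exact ⟨x, ((Relation.EqvGen.rel _ _ hst).symm _ _).trans _ _ _ hx, hx'⟩
      · rintro ⟨x, hx, hx'⟩
        exact ⟨x, (Relation.EqvGen.rel _ _ hst).trans _ _ _ hx, hx'⟩
    have hbd : ∀ x, φ (bd x) = Sum.elim f g x := by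
      intro x
      rw [Bool.eq_iff_iff]
      simp only [φ, decide_eq_true_eq]
      constructor
      · rintro ⟨y, hy, hy'⟩
        rw [← hy']
        exact hfg x y hy
      · exact fun hx => ⟨x, Relation.EqvGen.refl _, hx⟩
    have hf : ∀ i, φ (.inl (.inl i)) = f i := fun i => hbd (.inl i)
    have hg : ∀ j, φ (.inr j) = g j := fun j => hbd (.inr j)
    refine ⟨List.ofFn fun j : Fin l => φ (.inl (.inr j)), ⟨f, _, rfl, rfl, ?_⟩,
      ⟨_, g, rfl, rfl, ?_⟩⟩
    · have key : ∀ z, Sum.elim f (fun j : Fin l => φ (.inl (.inr j))) z = φ (.inl z) := by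
        rintro (z | z)
        · exact (hf z).symm
        · rfl
      intro x y hxy
      exact (key x).trans ((hφ _ _ (.inl ⟨x, y, hxy, rfl, rfl⟩)).trans (key y).symm)
    · have key : ∀ z, Sum.elim (fun j : Fin l => φ (.inl (.inr j))) g z =
          φ (compEmbMid q p rfl z) := by
        rintro (z | z)
        · rfl
        · exact (hg z).symm
      intro x y hxy
      exact (key x).trans ((hφ _ _ (.inr ⟨x, y, hxy, rfl, rfl⟩)).trans (key y).symm)
  · rintro ⟨_, ⟨f, e, rfl, rfl, h1⟩, ⟨e', g, he, rfl, h2⟩⟩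
    have he' : e = e' := List.ofFn_inj.1 he
    subst he'
    refine ⟨f, g, rfl, rfl, ?_⟩
    change Fin k → Bool at f
    change Fin l → Bool at e
    change Fin m → Bool at g
    let φ : (Fin k ⊕ Fin l) ⊕ Fin m → Bool := Sum.elim (Sum.elim f e) g
    have hφ : ∀ s t, compRel q p rfl s t → φ s = φ t := by
      rintro s t (⟨x, y, hxy, rfl, rfl⟩ | ⟨x, y, hxy, rfl, rfl⟩)
      · exact h1 x y hxy
      · have key : ∀ z, φ (compEmbMid q p rfl z) = Sum.elim e g z := by
          rintro (z | z) <;> rfl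
        exact (key x).trans ((h2 x y hxy).trans (key y).symm)
    intro x y hxy
    have h3 := eqvGen_apply_eq hφ hxy
    rcases x with x | x <;> rcases y with y | y <;> exact h3

theorem sem_invol (p : TCP) (a b : List Bool) : sem (invol p) a b ↔ sem p b a := by
  have key : ∀ (f : Fin p.k → Bool) (g : Fin p.l → Bool) z,
      Sum.elim g f z = Sum.elim f g (Sum.swap z) := by
    rintro f g (z | z) <;> rfl
  constructor
  · rintro ⟨g, f, rfl, rfl, h⟩
    refine ⟨f, g, rfl, rfl, fun x y hxy => ?_⟩
    have := h x.swap y.swap (by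
      change p.rel.r x.swap.swap y.swap.swap
      simpa using hxy)
    refine Eq.trans ?_ (this.trans ?_)
    · refine Eq.trans ?_ (key f g x.swap).symm; rw [Sum.swap_swap]
    · refine (key f g y.swap).trans ?_; rw [Sum.swap_swap]
  · rintro ⟨f, g, rfl, rfl, h⟩
    exact ⟨g, f, rfl, rfl, fun x y hxy => (key f g x).trans ((h _ _ hxy).trans (key f g y).symm)⟩

theorem sem_idPart (c : Color) (a b : List Bool) : sem (idPart c) a b ↔ ∃ x, a = [x] ∧ b = [x] := by
  constructor
  · rintro ⟨f, g, rfl, rfl, h⟩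
    change Fin 1 → Bool at f
    change Fin 1 → Bool at g
    have : f 0 = g 0 := h (.inl (0 : Fin 1)) (.inr (0 : Fin 1)) trivial
    refine ⟨f 0, rfl, ?_⟩
    rw [this]
    rfl
  · rintro ⟨x, rfl, rfl⟩
    refine ⟨fun _ => x, fun _ => x, rfl, rfl, ?_⟩
    rintro (u | u) (v | v) - <;> rfl

theorem sem_mkLower (n : ℕ) (color : Fin n → Color) (lbl : Fin n → ℕ) (a b : List Bool) :
    sem (mkLower n color lbl) a b ↔
      a = [] ∧ ∃ g : Fin n → Bool, b = List.ofFn g ∧ ∀ i j, lbl i = lbl j → g i = g j := by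
  constructor
  · rintro ⟨f, g, rfl, rfl, h⟩
    exact ⟨rfl, g, rfl, fun i j hij => h (.inr i) (.inr j) hij⟩
  · rintro ⟨rfl, g, rfl, h⟩
    refine ⟨Fin.elim0, g, rfl, rfl, ?_⟩
    rintro (x | x) (y | y) hxy
    · exact x.elim0
    · exact x.elim0
    · exact y.elim0
    · exact h x y hxy

theorem sem_pairLower (c₁ c₂ : Color) (a b : List Bool) :
    sem (pairLower c₁ c₂) a b ↔ a = [] ∧ ∃ x, b = [x, x] := by
  rw [pairLower, sem_mkLower]
  refine and_congr_right fun _ => ?_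
  constructor
  · rintro ⟨g, rfl, h⟩
    refine ⟨g 0, ?_⟩
    simp [List.ofFn_succ, h 1 0 rfl]
  · rintro ⟨x, rfl⟩
    exact ⟨fun _ => x, rfl, fun _ _ _ => rfl⟩

theorem sem_singl (c : Color) (a b : List Bool) :
    sem (singl c) a b ↔ a = [] ∧ ∃ x, b = [x] := by
  rw [singl, sem_mkLower]
  refine and_congr_right fun _ => ?_
  constructor
  · rintro ⟨g, rfl, h⟩
    exact ⟨g 0, rfl⟩
  · rintro ⟨x, rfl⟩
    exact ⟨fun _ => x, rfl, fun _ _ _ => rfl⟩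

/-! ### Membership of words with a relation on labellings -/

/-- Some partition in `C` has the given color words and the given relation on labellings. -/
def Mem (C : Set TCP) (u v : List Color) (R : List Bool → List Bool → Prop) : Prop :=
  ∃ p ∈ C, upWord p = u ∧ lowWord p = v ∧ ∀ a b, sem p a b ↔ R a b

theorem mem_iff_mem_sem {C : Set TCP} {p : TCP} :
    p ∈ C ↔ Mem C (upWord p) (lowWord p) (sem p) := by
  constructor
  · exact fun h => ⟨p, h, rfl, rfl, fun _ _ => Iff.rfl⟩
  · rintro ⟨q, hq, hu, hl, hs⟩
    rwa [← eq_of_sem hu hl hs]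

theorem Mem.congr {C : Set TCP} {u v u' v' : List Color} {R R' : List Bool → List Bool → Prop}
    (h : Mem C u v R) (hu : u = u') (hv : v = v') (hR : ∀ a b, R a b ↔ R' a b) :
    Mem C u' v' R' := by
  obtain ⟨p, hp, h1, h2, h3⟩ := h
  exact ⟨p, hp, h1.trans hu, h2.trans hv, fun a b => (h3 a b).trans (hR a b)⟩

theorem Mem.length {C : Set TCP} {u v : List Color} {R : List Bool → List Bool → Prop}
    (h : Mem C u v R) {a b : List Bool} (hab : R a b) :
    a.length = u.length ∧ b.length = v.length := by
  obtain ⟨p, hp, rfl, rfl, h3⟩ := h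
  exact ⟨((h3 a b).2 hab).length_up, ((h3 a b).2 hab).length_low⟩

theorem Mem.tensor {C : Set TCP} (hC : IsCategory C) {u v u' v' : List Color}
    {R R' : List Bool → List Bool → Prop} (h : Mem C u v R) (h' : Mem C u' v' R') :
    Mem C (u ++ u') (v ++ v') (fun a b => ∃ a₁ a₂ b₁ b₂, a = a₁ ++ a₂ ∧ b = b₁ ++ b₂ ∧
      R a₁ b₁ ∧ R' a₂ b₂) := by
  obtain ⟨p, hp, rfl, rfl, h3⟩ := h
  obtain ⟨q, hq, rfl, rfl, h4⟩ := h'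
  refine ⟨_, hC.tensor_mem p hp q hq, upWord_tensor p q, lowWord_tensor p q, fun a b => ?_⟩
  rw [sem_tensor]
  simp only [h3, h4]

theorem Mem.comp {C : Set TCP} (hC : IsCategory C) {u v w : List Color}
    {R S : List Bool → List Bool → Prop} (h : Mem C u v R) (h' : Mem C v w S) :
    Mem C u w (fun a c => ∃ b, R a b ∧ S b c) := by
  obtain ⟨q, hq, rfl, hqv, h3⟩ := h
  obtain ⟨p, hp, hpv, rfl, h4⟩ := h'
  have hw : lowWord q = upWord p := hqv.trans hpv.symm
  have hlen : q.l = p.k := by simpa [upWord, lowWord] using congrArg List.length hw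
  refine ⟨_, hC.comp_mem q hq p hp hlen ?_, rfl, rfl, fun a b => ?_⟩
  · intro j
    have h5 : (lowWord q)[j.1]'(by simp [lowWord]) =
        (upWord p)[j.1]'(by simp [upWord, ← hlen]) := by simp only [hw]
    simp only [lowWord, upWord, List.getElem_ofFn] at h5
    exact h5
  · rw [sem_comp]
    simp only [h3, h4]

theorem Mem.invol {C : Set TCP} (hC : IsCategory C) {u v : List Color}
    {R : List Bool → List Bool → Prop} (h : Mem C u v R) :
    Mem C v u (fun a b => R b a) := by
  obtain ⟨p, hp, rfl, rfl, h3⟩ := h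
  exact ⟨_, hC.invol_mem p hp, rfl, rfl, fun a b => (sem_invol p a b).trans (h3 b a)⟩

theorem Mem.id_single {C : Set TCP} (hC : IsCategory C) (c : Color) :
    Mem C [c] [c] (fun a b => ∃ x, a = [x] ∧ b = [x]) := by
  refine ⟨idPart c, ?_, rfl, rfl, sem_idPart c⟩
  cases c
  · exact hC.idb_mem
  · exact hC.idw_mem

/-- The empty partition lies in every category. -/
theorem Mem.empty {C : Set TCP} (hC : IsCategory C) :
    Mem C [] [] (fun a b => a = [] ∧ b = []) := by
  have h : Mem C [] [white, black] (fun a b => a = [] ∧ ∃ x, b = [x, x]) :=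
    ⟨_, hC.pairwb_mem, rfl, rfl, sem_pairLower _ _⟩
  refine (h.comp hC (h.invol hC)).congr rfl rfl fun a b => ?_
  constructor
  · rintro ⟨c, ⟨rfl, -⟩, rfl, -⟩
    exact ⟨rfl, rfl⟩
  · rintro ⟨rfl, rfl⟩
    exact ⟨[true, true], ⟨rfl, true, rfl⟩, rfl, true, rfl⟩

theorem Mem.id {C : Set TCP} (hC : IsCategory C) (w : List Color) :
    Mem C w w (fun a b => a = b ∧ b.length = w.length) := by
  induction w with
  | nil =>
    refine (Mem.empty hC).congr rfl rfl fun a b => ?_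
    constructor
    · rintro ⟨rfl, rfl⟩; exact ⟨rfl, rfl⟩
    · rintro ⟨rfl, h⟩
      have := List.length_eq_zero_iff.1 h
      exact ⟨this, this⟩
  | cons c w ih =>
    refine ((Mem.id_single hC c).tensor hC ih).congr rfl rfl fun a b => ?_
    constructor
    · rintro ⟨_, _, _, _, rfl, rfl, ⟨x, rfl, rfl⟩, rfl, h⟩
      exact ⟨rfl, by simpa using h⟩
    · rintro ⟨rfl, h⟩
      obtain ⟨x, a, rfl⟩ := List.exists_cons_of_length_eq_add_one h
      exact ⟨[x], a, [x], a, rfl, rfl, ⟨x, rfl, rfl⟩, rfl, by simpa using h⟩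

/-- Membership of partitions without upper points. -/
def LMem (C : Set TCP) (w : List Color) (F : List Bool → Prop) : Prop :=
  Mem C [] w (fun a b => a = [] ∧ F b)

theorem LMem.congr {C : Set TCP} {w w' : List Color} {F F' : List Bool → Prop}
    (h : LMem C w F) (hw : w = w') (hF : ∀ f, F f ↔ F' f) : LMem C w' F' :=
  Mem.congr h rfl hw fun a b => by rw [hF]

theorem LMem.length {C : Set TCP} {w : List Color} {F : List Bool → Prop}
    (h : LMem C w F) {f : List Bool} (hf : F f) : f.length = w.length :=
  (Mem.length h ⟨rfl, hf⟩).2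

theorem LMem.apply {C : Set TCP} (hC : IsCategory C) {v w : List Color} {F : List Bool → Prop}
    {R : List Bool → List Bool → Prop} (h : LMem C v F) (h' : Mem C v w R) :
    LMem C w (fun f => ∃ g, F g ∧ R g f) := by
  refine (Mem.comp hC h h').congr rfl rfl fun a b => ?_
  constructor
  · rintro ⟨c, ⟨rfl, hc⟩, hcb⟩; exact ⟨rfl, c, hc, hcb⟩
  · rintro ⟨rfl, c, hc, hcb⟩; exact ⟨c, ⟨rfl, hc⟩, hcb⟩

theorem LMem.pair {C : Set TCP} (hC : IsCategory C) (c : Color) :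
    LMem C [c, !c] (fun f => ∃ x, f = [x, x]) := by
  refine ⟨pairLower c (!c), ?_, rfl, rfl, fun a b => sem_pairLower _ _ a b⟩
  cases c
  · exact hC.pairbw_mem
  · exact hC.pairwb_mem

/-- The relation which tensors `R` with identities on both sides. -/
theorem Mem.whisker {C : Set TCP} (hC : IsCategory C) (A B : List Color) {u v : List Color}
    {R : List Bool → List Bool → Prop} (h : Mem C u v R) :
    Mem C (A ++ (u ++ B)) (A ++ (v ++ B)) (fun f g => ∃ a x y b, f = a ++ (x ++ b) ∧
      g = a ++ (y ++ b) ∧ a.length = A.length ∧ b.length = B.length ∧ R x y) := by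
  refine ((Mem.id hC A).tensor hC (h.tensor hC (Mem.id hC B))).congr rfl rfl fun f g => ?_
  constructor
  · rintro ⟨_, _, _, _, rfl, rfl, ⟨rfl, hA⟩, _, _, _, _, rfl, rfl, hR, rfl, hB⟩
    exact ⟨_, _, _, _, rfl, rfl, hA, hB, hR⟩
  · rintro ⟨a, x, y, b, rfl, rfl, hA, hB, hR⟩
    exact ⟨_, _, _, _, rfl, rfl, ⟨rfl, hA⟩, _, _, _, _, rfl, rfl, hR, rfl, hB⟩

/-- Insertion of one lower partition into another one. -/
theorem LMem.insert {C : Set TCP} (hC : IsCategory C) {A B V : List Color}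
    {F G : List Bool → Prop} (h : LMem C (A ++ B) F) (h' : LMem C V G) :
    LMem C (A ++ (V ++ B)) (fun f => ∃ a v b, f = a ++ (v ++ b) ∧ a.length = A.length ∧
      b.length = B.length ∧ F (a ++ b) ∧ G v) := by
  refine (h.apply hC (Mem.whisker hC A B h')).congr rfl fun f => ?_
  constructor
  · rintro ⟨_, hF, a, _, v, b, rfl, rfl, hA, hB, rfl, hv⟩
    exact ⟨a, v, b, rfl, hA, hB, hF, hv⟩
  · rintro ⟨a, v, b, rfl, hA, hB, hF, hv⟩
    exact ⟨_, hF, a, [], v, b, rfl, rfl, hA, hB, rfl, hv⟩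

/-- Removal of a segment of a lower partition by pairing it with another lower partition. -/
theorem LMem.remove {C : Set TCP} (hC : IsCategory C) {A B V : List Color}
    {F G : List Bool → Prop} (h : LMem C (A ++ (V ++ B)) F) (h' : LMem C V G) :
    LMem C (A ++ B) (fun f => ∃ a v b, f = a ++ b ∧ a.length = A.length ∧
      b.length = B.length ∧ F (a ++ (v ++ b)) ∧ G v) := by
  refine (h.apply hC (Mem.whisker hC A B (Mem.invol hC h'))).congr rfl fun f => ?_
  constructor
  · rintro ⟨_, hF, a, v, _, b, rfl, rfl, hA, hB, rfl, hv⟩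
    exact ⟨a, v, b, rfl, hA, hB, hF, hv⟩
  · rintro ⟨a, v, b, rfl, hA, hB, hF, hv⟩
    exact ⟨_, hF, a, v, [], b, rfl, rfl, hA, hB, rfl, hv⟩

/-- The reversed word with inverted colors. -/
def winv (w : List Color) : List Color := (w.map (!·)).reverse

@[simp] theorem winv_length (w : List Color) : (winv w).length = w.length := by simp [winv]

@[simp] theorem winv_winv (w : List Color) : winv (winv w) = w := by
  simp [winv, List.map_reverse, Function.comp_def]

theorem winv_cons (c : Color) (w : List Color) : winv (c :: w) = winv w ++ [!c] := by
  simp [winv]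

theorem winv_append (v w : List Color) : winv (v ++ w) = winv w ++ winv v := by
  simp [winv]

/-- Nested bicolored pairs. -/
theorem LMem.nested {C : Set TCP} (hC : IsCategory C) (w : List Color) :
    LMem C (winv w ++ w) (fun f => ∃ a, f = a.reverse ++ a ∧ a.length = w.length) := by
  induction w with
  | nil =>
    refine Mem.congr (Mem.empty hC) rfl rfl fun a b => ?_
    simp
  | cons c w ih =>
    refine (ih.insert hC (LMem.pair hC (!c))).congr (by simp [winv_cons]) fun f => ?_
    constructor
    · rintro ⟨a, v, b, rfl, hA, hB, ⟨e, he, hl⟩, x, rfl⟩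
      obtain ⟨rfl, rfl⟩ := List.append_inj he (by simp_all)
      exact ⟨x :: b, by simp, by simp [hl]⟩
    · rintro ⟨e, rfl, hl⟩
      obtain ⟨x, e, rfl⟩ := List.exists_cons_of_length_eq_add_one hl
      have hl' : e.length = w.length := by simpa using hl
      exact ⟨e.reverse, [x, x], e, by simp, by simp [hl'], hl', ⟨e, rfl, hl'⟩, x, rfl⟩

theorem LMem.nested_inv {C : Set TCP} (hC : IsCategory C) (w : List Color) :
    LMem C (w ++ winv w) (fun f => ∃ a, f = a ++ a.reverse ∧ a.length = w.length) := by
  refine (LMem.nested hC (winv w)).congr (by simp) fun f => ?_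
  constructor
  · rintro ⟨a, rfl, h⟩; exact ⟨a.reverse, by simp, by simpa using h⟩
  · rintro ⟨a, rfl, h⟩; exact ⟨a.reverse, by simp, by simpa using h⟩

/-- Verticolor reflection. -/
theorem LMem.reflect {C : Set TCP} (hC : IsCategory C) {w : List Color} {F : List Bool → Prop}
    (h : LMem C w F) : LMem C (winv w) (fun f => F f.reverse) := by
  have h1 : LMem C (winv w ++ (w ++ [])) _ :=
    (LMem.nested hC w).congr (by simp) fun _ => Iff.rfl
  refine (h1.remove hC h).congr (by simp) fun f => ?_
  constructor
  · rintro ⟨a, v, b, rfl, hA, hB, ⟨e, he, hl⟩, hv⟩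
    obtain rfl : b = [] := List.length_eq_zero_iff.1 hB
    obtain ⟨rfl, h2⟩ := List.append_inj he (by simp_all)
    simp only [List.append_nil] at h2
    subst h2
    simpa using hv
  · intro hf
    have hl := h.length hf
    exact ⟨f, f.reverse, [], by simp, by simpa using hl, rfl, ⟨f.reverse, by simp, hl⟩, hf⟩

/-- Cyclic rotation. -/
theorem LMem.rotate {C : Set TCP} (hC : IsCategory C) {A B : List Color} {F : List Bool → Prop}
    (h : LMem C (A ++ B) F) :
    LMem C (B ++ A) (fun f => ∃ a b, f = b ++ a ∧ a.length = A.length ∧ b.length = B.length ∧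
      F (a ++ b)) := by
  have h1 : LMem C ([] ++ ((winv A ++ A) ++ (B ++ A))) _ :=
    ((LMem.nested hC A).insert hC h).congr (by simp) fun f => Iff.rfl
  refine (h1.remove hC (LMem.nested hC A)).congr (by simp) fun f => ?_
  constructor
  · rintro ⟨a₀, v, b₀, rfl, hA, hB, ⟨a, v', b, he, ha, hb, ⟨e, he', hl⟩, hF⟩, e', rfl, hl'⟩
    obtain rfl : a₀ = [] := List.length_eq_zero_iff.1 hA
    obtain ⟨rfl, rfl⟩ := List.append_inj he' (by simp_all)
    simp only [List.nil_append, List.append_assoc] at he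
    obtain ⟨h2, h3⟩ := List.append_inj he (by simp_all)
    obtain rfl := List.reverse_injective h2
    have hF' := h.length hF
    have hle : e'.length ≤ v'.length := by
      rw [hF', List.length_append]; omega
    have hx : ∃ x, v' = e' ++ x ∧ b₀ = x ++ e' := by
      refine ⟨v'.drop e'.length, ?_, ?_⟩
      · have h4 := congrArg (List.take e'.length) h3
        rw [List.take_left, List.take_append_of_le_length hle] at h4
        conv_lhs => rw [← List.take_append_drop e'.length v', ← h4]
      · have h4 := congrArg (List.drop e'.length) h3
        rwa [List.drop_left, List.drop_append_of_le_length hle] at h4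
    obtain ⟨x, rfl, rfl⟩ := hx
    exact ⟨e', x, by simp, hl, by simp only [List.length_append] at hF'; omega, hF⟩
  · rintro ⟨a, b, rfl, ha, hb, hF⟩
    refine ⟨[], a.reverse ++ a, b ++ a, by simp, rfl, by simp [ha, hb],
      ⟨a.reverse, a ++ b, a, by simp, by simpa using ha, ha, ⟨a, rfl, ha⟩, hF⟩, a, rfl, ha⟩

/-- Rotating all upper points down to the left. -/
theorem Mem.bend {C : Set TCP} (hC : IsCategory C) {u v : List Color}
    {R : List Bool → List Bool → Prop} (h : Mem C u v R) :
    LMem C (winv u ++ v) (fun f => ∃ a b, f = a.reverse ++ b ∧ R a b) := by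
  have h1 := Mem.whisker hC (winv u) [] h
  simp only [List.append_nil] at h1
  refine ((LMem.nested hC u).apply hC h1).congr rfl fun f => ?_
  constructor
  · rintro ⟨_, ⟨e, rfl, hl⟩, a, x, y, b, he, rfl, hA, hB, hR⟩
    obtain rfl : b = [] := List.length_eq_zero_iff.1 hB
    obtain ⟨rfl, h2⟩ := List.append_inj he (by simp_all)
    simp only [List.append_nil] at h2
    subst h2
    exact ⟨e, y, by simp, hR⟩
  · rintro ⟨a, b, rfl, hR⟩
    have hl := (h.length hR).1
    exact ⟨a.reverse ++ a, ⟨a, rfl, hl⟩, a.reverse, a, b, [], by simp, by simp, by simpa using hl,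
      rfl, hR⟩

/-- Rotating a left segment of the lower points up. -/
theorem LMem.unbend {C : Set TCP} (hC : IsCategory C) {u v : List Color} {F : List Bool → Prop}
    (h : LMem C (winv u ++ v) F) :
    Mem C u v (fun a b => a.length = u.length ∧ F (a.reverse ++ b)) := by
  have h1 : Mem C u (u ++ winv u ++ v) _ :=
    ((Mem.id hC u).tensor hC h).congr (by simp) (by simp) fun _ _ => Iff.rfl
  have h2 : Mem C (u ++ winv u ++ v) v _ :=
    (((LMem.nested_inv hC u).invol hC).tensor hC (Mem.id hC v)).congr rfl (by simp)
      fun _ _ => Iff.rfl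
  refine (h1.comp hC h2).congr rfl rfl fun a b => ?_
  constructor
  · rintro ⟨c, ⟨a₁, a₂, b₁, b₂, rfl, rfl, ⟨rfl, hl⟩, rfl, hF⟩, d₁, d₂, e₁, e₂, he, rfl,
      ⟨rfl, x, rfl, hx⟩, rfl, hd⟩
    rw [List.append_assoc] at he
    obtain ⟨rfl, rfl⟩ := List.append_inj he (by simp_all)
    simpa using ⟨hl, hF⟩
  · rintro ⟨hl, hF⟩
    have hl' := h.length hF
    exact ⟨a ++ (a.reverse ++ b), ⟨a, [], a, a.reverse ++ b, by simp, rfl, ⟨rfl, hl⟩, rfl, hF⟩,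
      a ++ a.reverse, b, [], b, by simp, rfl, ⟨rfl, a, rfl, hl⟩, rfl, by simp_all⟩

/-! ### Single-block patterns -/

/-- The sign of a color. -/
def sgn (c : Color) : ℤ := if c then 1 else -1

/-- The signed number of points of a color word. -/
def csum (w : List Color) : ℤ := (w.map sgn).sum

@[simp] theorem sgn_not (c : Color) : sgn (!c) = -sgn c := by cases c <;> simp [sgn]

@[simp] theorem csum_nil : csum [] = 0 := rfl

@[simp] theorem csum_cons (c : Color) (w : List Color) : csum (c :: w) = sgn c + csum w := by
  simp [csum]

@[simp] theorem csum_append (v w : List Color) : csum (v ++ w) = csum v + csum w := by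
  simp [csum]

@[simp] theorem csum_winv (w : List Color) : csum (winv w) = -csum w := by
  induction w with
  | nil => rfl
  | cons c w ih => rw [winv_cons]; simp [ih]

@[simp] theorem csum_replicate (n : ℕ) (c : Color) : csum (List.replicate n c) = n * sgn c := by
  simp [csum]

theorem exists_csum_eq (n : ℤ) : ∃ w, csum w = n := by
  obtain ⟨m, rfl | rfl⟩ := n.eq_nat_or_neg
  · exact ⟨List.replicate m true, by simp [sgn]⟩
  · exact ⟨List.replicate m false, by simp [sgn]⟩

theorem eq_replicate_or_exists_change (w : List Color) :
    (∃ c, w = List.replicate w.length c) ∨ ∃ A c B, w = A ++ (c :: (!c) :: B) := by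
  induction w with
  | nil => exact .inl ⟨true, rfl⟩
  | cons x w ih =>
    rcases ih with ⟨c, hc⟩ | ⟨A, c, B, rfl⟩
    · cases w with
      | nil => exact .inl ⟨x, rfl⟩
      | cons y w =>
        by_cases hxy : y = x
        · subst hxy
          obtain rfl : y = c := by simpa [List.replicate_succ] using (List.cons.inj hc).1
          refine .inl ⟨y, ?_⟩
          conv_lhs => rw [hc]
          rfl
        · refine .inr ⟨[], x, w, ?_⟩
          have : y = !x := by cases x <;> cases y <;> simp_all
          simp [this]
    · exact .inr ⟨x :: A, c, B, rfl⟩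

theorem exists_change_of_csum_eq_zero {w : List Color} (h : csum w = 0) (hw : w ≠ []) :
    ∃ A c B, w = A ++ (c :: (!c) :: B) := by
  rcases eq_replicate_or_exists_change w with ⟨c, hc⟩ | h'
  · rw [hc, csum_replicate] at h
    have h1 : (w.length : ℤ) ≠ 0 := by simpa using hw
    have h2 : sgn c ≠ 0 := by cases c <;> simp [sgn]
    exact absurd h (mul_ne_zero h1 h2)
  · exact h'

/-- Colored points flagged by whether they belong to a distinguished block; all other points
are singletons. -/
abbrev Pat := List (Color × Bool)

/-- A labelling of a pattern which takes the value `ξ` on the distinguished block. -/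
def Fits (ξ : Bool) (P : Pat) (f : List Bool) : Prop :=
  List.Forall₂ (fun l b => l.2 = true → b = ξ) P f

/-- The labellings of a pattern which are constant on the distinguished block. -/
def psem (P : Pat) (f : List Bool) : Prop := ∃ ξ, Fits ξ P f

/-- The pattern consisting of singletons only. -/
def fr (w : List Color) : Pat := w.map (·, false)

/-- The color word of a pattern. -/
def cols (P : Pat) : List Color := P.map Prod.fst

@[simp] theorem cols_nil : cols [] = [] := rfl
@[simp] theorem cols_cons (l : Color × Bool) (P : Pat) : cols (l :: P) = l.1 :: cols P := rfl
@[simp] theorem cols_append (P Q : Pat) : cols (P ++ Q) = cols P ++ cols Q := by simp [cols]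
@[simp] theorem cols_fr (w : List Color) : cols (fr w) = w := by simp [cols, fr, Function.comp_def]
@[simp] theorem fr_append (v w : List Color) : fr (v ++ w) = fr v ++ fr w := by simp [fr]
@[simp] theorem fr_nil : fr [] = [] := rfl
@[simp] theorem fr_cons (c : Color) (w : List Color) : fr (c :: w) = (c, false) :: fr w := rfl
@[simp] theorem fr_length (w : List Color) : (fr w).length = w.length := by simp [fr]
@[simp] theorem cols_length (P : Pat) : (cols P).length = P.length := by simp [cols]

theorem Fits.length {ξ : Bool} {P : Pat} {f : List Bool} (h : Fits ξ P f) :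
    f.length = P.length := (List.Forall₂.length_eq h).symm

theorem fits_append_iff {ξ : Bool} {P Q : Pat} {f : List Bool} :
    Fits ξ (P ++ Q) f ↔ ∃ a b, f = a ++ b ∧ Fits ξ P a ∧ Fits ξ Q b := by
  constructor
  · intro h
    refine ⟨f.take P.length, f.drop P.length, (List.take_append_drop _ _).symm, ?_, ?_⟩
    · simpa [Fits] using List.forall₂_take P.length h
    · simpa [Fits] using List.forall₂_drop P.length h
  · rintro ⟨a, b, rfl, h1, h2⟩
    exact List.rel_append h1 h2

theorem fits_append {ξ : Bool} {P Q : Pat} {a b : List Bool} (h : a.length = P.length) :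
    Fits ξ (P ++ Q) (a ++ b) ↔ Fits ξ P a ∧ Fits ξ Q b := by
  rw [fits_append_iff]
  constructor
  · rintro ⟨a', b', he, h1, h2⟩
    obtain ⟨rfl, rfl⟩ := List.append_inj he (by rw [h, h1.length])
    exact ⟨h1, h2⟩
  · exact fun hh => ⟨a, b, rfl, hh⟩

@[simp] theorem fits_nil {ξ : Bool} {f : List Bool} : Fits ξ [] f ↔ f = [] := by
  simp [Fits]

theorem fits_cons_iff {ξ : Bool} {l : Color × Bool} {P : Pat} {f : List Bool} :
    Fits ξ (l :: P) f ↔ ∃ x g, f = x :: g ∧ (l.2 = true → x = ξ) ∧ Fits ξ P g := by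
  simp only [Fits, List.forall₂_cons_left_iff]
  constructor
  · rintro ⟨x, g, h1, h2, h3⟩; exact ⟨x, g, h3, h1, h2⟩
  · rintro ⟨x, g, h1, h2, h3⟩; exact ⟨x, g, h2, h3, h1⟩

@[simp] theorem fits_cons {ξ : Bool} {l : Color × Bool} {P : Pat} {x : Bool} {g : List Bool} :
    Fits ξ (l :: P) (x :: g) ↔ (l.2 = true → x = ξ) ∧ Fits ξ P g := by
  simp [Fits]

@[simp] theorem fits_fr {ξ : Bool} {w : List Color} {f : List Bool} :
    Fits ξ (fr w) f ↔ f.length = w.length := by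
  induction w generalizing f with
  | nil => simp
  | cons c w ih =>
    cases f with
    | nil => simp [Fits]
    | cons x f => simp [ih]

theorem fits_replicate (ξ : Bool) (P : Pat) : Fits ξ P (List.replicate P.length ξ) := by
  induction P with
  | nil => simp
  | cons l P ih => simp [List.replicate_succ, ih]

@[simp] theorem psem_fr {w : List Color} {f : List Bool} :
    psem (fr w) f ↔ f.length = w.length := by simp [psem]

/-- The pattern `P` lies in `C`. -/
def PMem (C : Set TCP) (P : Pat) : Prop := LMem C (cols P) (psem P)

/-- The word `w`, all of whose points are singletons, lies in `C`. -/
def Sing (C : Set TCP) (w : List Color) : Prop := LMem C w (fun f => f.length = w.length)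

theorem pMem_fr {C : Set TCP} {w : List Color} : PMem C (fr w) ↔ Sing C w := by
  constructor
  · exact fun h => LMem.congr h (by simp) (by simp)
  · exact fun h => LMem.congr h (by simp) (by simp)

section Category

variable {C : Set TCP}

theorem PMem.pair (c : Color) (hC : IsCategory C) : PMem C [(c, true), (!c, true)] := by
  refine (LMem.pair hC c).congr rfl fun f => ?_
  constructor
  · rintro ⟨x, rfl⟩
    exact ⟨x, by simp⟩
  · rintro ⟨x, h⟩
    simp only [fits_cons_iff, fits_nil] at h
    obtain ⟨_, _, rfl, h1, _, _, rfl, h2, rfl⟩ := h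
    exact ⟨x, by simp_all⟩

theorem PMem.insert_sing (hC : IsCategory C) {P Q : Pat} {V : List Color}
    (h : PMem C (P ++ Q)) (hV : Sing C V) : PMem C (P ++ (fr V ++ Q)) := by
  have h' : LMem C (cols P ++ cols Q) (psem (P ++ Q)) := h.congr (by simp) fun _ => Iff.rfl
  refine (h'.insert hC hV).congr (by simp) fun f => ?_
  constructor
  · rintro ⟨a, v, b, rfl, ha, hb, ⟨ξ, hξ⟩, hv⟩
    simp only [cols_length] at ha
    rw [fits_append ha] at hξ
    exact ⟨ξ, by rw [fits_append ha, fits_append (by simpa using hv)]; simpa [hv] using hξ⟩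
  · rintro ⟨ξ, hξ⟩
    rw [fits_append_iff] at hξ
    obtain ⟨a, _, rfl, ha, hξ⟩ := hξ
    rw [fits_append_iff] at hξ
    obtain ⟨v, b, rfl, hv, hb⟩ := hξ
    exact ⟨a, v, b, rfl, by simp [ha.length], by simp [hb.length],
      ⟨ξ, (fits_append ha.length).2 ⟨ha, hb⟩⟩, by simpa using hv⟩

theorem PMem.remove_sing (hC : IsCategory C) {P Q : Pat} {V : List Color}
    (h : PMem C (P ++ (fr V ++ Q))) (hV : Sing C V) : PMem C (P ++ Q) := by
  have h' : LMem C (cols P ++ (V ++ cols Q)) (psem (P ++ (fr V ++ Q))) :=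
    h.congr (by simp) fun _ => Iff.rfl
  refine (h'.remove hC hV).congr (by simp) fun f => ?_
  constructor
  · rintro ⟨a, v, b, rfl, ha, hb, ⟨ξ, hξ⟩, hv⟩
    simp only [cols_length] at ha
    rw [fits_append ha, fits_append (by simpa using hv)] at hξ
    exact ⟨ξ, (fits_append ha).2 ⟨hξ.1, hξ.2.2⟩⟩
  · rintro ⟨ξ, hξ⟩
    rw [fits_append_iff] at hξ
    obtain ⟨a, b, rfl, ha, hb⟩ := hξ
    refine ⟨a, List.replicate V.length true, b, rfl, by simp [ha.length], by simp [hb.length],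
      ⟨ξ, ?_⟩, by simp⟩
    rw [fits_append ha.length, fits_append (by simp)]
    simp [ha, hb]

theorem PMem.rotate (hC : IsCategory C) {P Q : Pat} (h : PMem C (P ++ Q)) :
    PMem C (Q ++ P) := by
  have h' : LMem C (cols P ++ cols Q) (psem (P ++ Q)) := h.congr (by simp) fun _ => Iff.rfl
  refine (h'.rotate hC).congr (by simp) fun f => ?_
  constructor
  · rintro ⟨a, b, rfl, ha, hb, ⟨ξ, hξ⟩⟩
    simp only [cols_length] at ha hb
    rw [fits_append ha] at hξ
    exact ⟨ξ, (fits_append hb).2 hξ.symm⟩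
  · rintro ⟨ξ, hξ⟩
    rw [fits_append_iff] at hξ
    obtain ⟨b, a, rfl, hb, ha⟩ := hξ
    exact ⟨a, b, rfl, by simp [ha.length], by simp [hb.length],
      ⟨ξ, (fits_append ha.length).2 ⟨ha, hb⟩⟩⟩

/-- The verticolor reflection of a pattern. -/
def pinv (P : Pat) : Pat := (P.map fun l => (!l.1, l.2)).reverse

theorem pinv_append (P Q : Pat) : pinv (P ++ Q) = pinv Q ++ pinv P := by simp [pinv]
theorem pinv_cons (l : Color × Bool) (P : Pat) : pinv (l :: P) = pinv P ++ [(!l.1, l.2)] := by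
  simp [pinv]
theorem pinv_nil : pinv [] = [] := rfl
theorem pinv_fr (w : List Color) : pinv (fr w) = fr (winv w) := by
  simp [pinv, fr, winv, List.map_reverse, Function.comp_def]

theorem cols_pinv (P : Pat) : cols (pinv P) = winv (cols P) := by
  simp [pinv, cols, winv, List.map_reverse, Function.comp_def]

theorem fits_pinv {ξ : Bool} {P : Pat} {f : List Bool} :
    Fits ξ (pinv P) f ↔ Fits ξ P f.reverse := by
  rw [← List.reverse_reverse f]
  generalize f.reverse = g
  rw [List.reverse_reverse]
  simp only [Fits, pinv, List.forall₂_reverse_iff, List.forall₂_map_left_iff]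

theorem PMem.reflect (hC : IsCategory C) {P : Pat} (h : PMem C P) : PMem C (pinv P) :=
  (LMem.reflect hC h).congr (cols_pinv P).symm fun f => by simp [psem, fits_pinv]

/-- Joining the distinguished blocks of two patterns along a point. -/
theorem PMem.join (hC : IsCategory C) {P Q R : Pat} {c : Color}
    (h : PMem C (P ++ ((c, true) :: Q))) (h' : PMem C ((!c, true) :: R)) :
    PMem C (P ++ (R ++ Q)) := by
  have h1 : LMem C (cols (P ++ [(c, true)]) ++ cols Q) (psem (P ++ ((c, true) :: Q))) :=
    h.congr (by simp) fun _ => Iff.rfl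
  have h2 : LMem C (cols P ++ ([c, !c] ++ cols (R ++ Q))) _ :=
    (h1.insert hC h').congr (by simp) fun _ => Iff.rfl
  refine (h2.remove hC (LMem.pair hC c)).congr (by simp) fun f => ?_
  constructor
  · rintro ⟨a, _, e, rfl, ha, he, ⟨a', v, b, hv, ha', hb, ⟨ξ, hξ⟩, ⟨ζ, hζ⟩⟩, z, rfl⟩
    simp only [fits_cons_iff, true_imp_iff] at hζ
    obtain ⟨z', r, rfl, rfl, hr⟩ := hζ
    have hsplit : a ++ ([z, z] ++ e) = (a ++ [z]) ++ (z :: e) := by simp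
    rw [hsplit] at hv
    simp only [cols_append, cols_cons, cols_nil, List.length_append, cols_length,
      List.length_cons, List.length_nil] at ha ha' he hb
    obtain ⟨rfl, hv'⟩ := List.append_inj hv (by simp [ha, ha'])
    simp only [List.cons_append, List.cons.injEq] at hv'
    obtain ⟨rfl, rfl⟩ := hv'
    rw [List.append_assoc, fits_append ha] at hξ
    simp only [List.cons_append, List.nil_append, fits_cons, true_imp_iff] at hξ
    obtain ⟨h3, rfl, h4⟩ := hξ
    exact ⟨z, by rw [fits_append ha, fits_append hr.length]; exact ⟨h3, hr, h4⟩⟩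
  · rintro ⟨ξ, hξ⟩
    rw [fits_append_iff] at hξ
    obtain ⟨a, _, rfl, ha, hξ⟩ := hξ
    rw [fits_append_iff] at hξ
    obtain ⟨r, b, rfl, hr, hb⟩ := hξ
    refine ⟨a, [ξ, ξ], r ++ b, rfl, by simp [ha.length], by simp [hr.length, hb.length],
      ⟨a ++ [ξ], ξ :: r, b, by simp, by simp [ha.length], by simp [hb.length],
        ⟨ξ, ?_⟩, ⟨ξ, by simp [hr]⟩⟩, ξ, rfl⟩
    rw [List.append_assoc, fits_append ha.length]
    simp [ha, hb]

end Category

/-! ### Categories containing the pair of singletons -/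

section Singletons

variable {C : Set TCP}

theorem sing_pair (hC : IsCategory C) (hs : singPair ∈ C) (c : Color) : Sing C [c, !c] := by
  have h : Sing C [white, black] := by
    refine ⟨singPair, hs, rfl, rfl, fun a b => ?_⟩
    rw [singPair, sem_tensor]
    simp only [sem_singl]
    constructor
    · rintro ⟨_, _, _, _, rfl, rfl, ⟨rfl, x, rfl⟩, rfl, y, rfl⟩
      exact ⟨rfl, rfl⟩
    · rintro ⟨rfl, h⟩
      obtain ⟨x, y, rfl⟩ := List.length_eq_two.1 h
      exact ⟨[], [], [x], [y], rfl, rfl, ⟨rfl, x, rfl⟩, rfl, y, rfl⟩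
  cases c
  · rw [← pMem_fr] at h ⊢
    exact PMem.rotate (P := [(white, false)]) (Q := [(black, false)]) hC h
  · exact h

theorem sing_nil (hC : IsCategory C) : Sing C [] :=
  Mem.congr (Mem.empty hC) rfl rfl fun a b => by simp

theorem Sing.insert (hC : IsCategory C) {A B V : List Color} (h : Sing C (A ++ B))
    (hV : Sing C V) : Sing C (A ++ (V ++ B)) := by
  rw [← pMem_fr] at h ⊢
  simp only [fr_append] at h ⊢
  exact h.insert_sing hC hV

theorem Sing.remove (hC : IsCategory C) {A B V : List Color} (h : Sing C (A ++ (V ++ B)))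
    (hV : Sing C V) : Sing C (A ++ B) := by
  rw [← pMem_fr] at h ⊢
  simp only [fr_append] at h ⊢
  exact h.remove_sing hC hV

theorem sing_of_csum_eq_zero (hC : IsCategory C) (hs : singPair ∈ C) {w : List Color}
    (h : csum w = 0) : Sing C w := by
  induction hn : w.length using Nat.strong_induction_on generalizing w with
  | _ n ih =>
    by_cases hw : w = []
    · subst hw; exact sing_nil hC
    · obtain ⟨A, c, B, rfl⟩ := exists_change_of_csum_eq_zero h hw
      have h1 : Sing C (A ++ B) :=
        ih (A ++ B).length (by simp at hn ⊢; omega) (by simpa using h) rfl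
      exact h1.insert hC (sing_pair hC hs c)

theorem Sing.congr (hC : IsCategory C) (hs : singPair ∈ C) {w w' : List Color} (h : Sing C w)
    (hw : csum w = csum w') : Sing C w' := by
  have h1 : Sing C (w ++ []) := by simpa using h
  have h2 := h1.insert hC (sing_of_csum_eq_zero hC hs (w := winv w ++ w') (by simp [hw]))
  have h3 : Sing C ([] ++ ((w ++ winv w) ++ w')) := by simpa using h2
  exact h3.remove hC (sing_of_csum_eq_zero hC hs (by simp))

/-- The subgroup of all values `c(p)` for `p ∈ C`. -/
def degreeSubgroup (hC : IsCategory C) : AddSubgroup ℤ where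
  carrier := {n | ∃ w, csum w = n ∧ Sing C w}
  zero_mem' := ⟨[], rfl, sing_nil hC⟩
  add_mem' := by
    rintro _ _ ⟨v, rfl, hv⟩ ⟨w, rfl, hw⟩
    have hv' : Sing C (v ++ []) := by simpa using hv
    exact ⟨v ++ (w ++ []), by simp, hv'.insert hC hw⟩
  neg_mem' := by
    rintro _ ⟨v, rfl, hv⟩
    refine ⟨winv v, by simp, ?_⟩
    rw [← pMem_fr] at hv ⊢
    rw [← pinv_fr]
    exact hv.reflect hC

theorem sing_iff (hC : IsCategory C) (hs : singPair ∈ C) {w : List Color} :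
    Sing C w ↔ csum w ∈ degreeSubgroup hC := by
  constructor
  · exact fun h => ⟨w, rfl, h⟩
  · rintro ⟨v, hv, h⟩
    exact h.congr hC hs hv

/-- A segment of singletons may be replaced by another one. -/
theorem PMem.replace_sing (hC : IsCategory C) (hs : singPair ∈ C) {P Q : Pat} {U U' : List Color}
    (h : PMem C (P ++ (fr U ++ Q))) (hU : csum U' - csum U ∈ degreeSubgroup hC) :
    PMem C (P ++ (fr U' ++ Q)) := by
  have h1 : PMem C ((P ++ fr U) ++ Q) := by simpa using h
  have h2 := h1.insert_sing hC (V := winv U ++ U')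
    ((sing_iff hC hs).2 (by simpa [add_comm, sub_eq_add_neg] using hU))
  have h3 : PMem C (P ++ (fr (U ++ winv U) ++ (fr U' ++ Q))) := by simpa using h2
  exact h3.remove_sing hC (sing_of_csum_eq_zero hC hs (by simp))

theorem mem_disconnect (hC : IsCategory C) (hs : singPair ∈ C) (c : Color) :
    Mem C [c] [c] (fun a b => ∃ x y, a = [x] ∧ b = [y]) := by
  have h : LMem C (winv [c] ++ [c]) (fun f => f.length = 2) := by
    have := sing_pair hC hs (!c)
    exact LMem.congr this (by simp [winv]) (by simp)
  refine (h.unbend hC).congr rfl rfl fun a b => ?_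
  constructor
  · rintro ⟨h1, h2⟩
    obtain ⟨x, rfl⟩ := List.length_eq_one_iff.1 h1
    have hb : b.length = 1 := by
      simp only [List.length_append, List.length_reverse, List.length_cons, List.length_nil] at h2
      omega
    obtain ⟨y, rfl⟩ := List.length_eq_one_iff.1 hb
    exact ⟨x, y, rfl, rfl⟩
  · rintro ⟨x, y, rfl, rfl⟩
    exact ⟨rfl, rfl⟩

/-- Two labellings agreeing on the distinguished points of a pattern. -/
def Agree : Pat → List Bool → List Bool → Prop
  | [], [], [] => True
  | l :: P, x :: g, y :: f => (l.2 = true → x = y) ∧ Agree P g f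
  | _, _, _ => False

theorem agree_iff {P : Pat} {g f : List Bool} :
    Agree P g f ↔ ∃ (hg : g.length = P.length) (hf : f.length = P.length),
      ∀ i (hi : i < P.length), P[i].2 = true → g[i] = f[i] := by
  induction P generalizing g f with
  | nil => cases g <;> cases f <;> simp [Agree]
  | cons l P ih =>
    cases g with
    | nil => simp [Agree]
    | cons x g =>
      cases f with
      | nil => simp [Agree]
      | cons y f =>
        rw [Agree, ih]
        constructor
        · rintro ⟨h1, h2, h3, h4⟩
          refine ⟨by simp [h2], by simp [h3], fun i hi => ?_⟩
          cases i with
          | zero => simpa using h1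
          | succ i => simpa using h4 i (by simpa using hi)
        · rintro ⟨h2, h3, h4⟩
          exact ⟨h4 0 (by simp), by simpa using h2, by simpa using h3,
            fun i hi => h4 (i + 1) (by simpa using hi)⟩

theorem mem_agree (hC : IsCategory C) (hs : singPair ∈ C) (P : Pat) :
    Mem C (cols P) (cols P) (Agree P) := by
  induction P with
  | nil =>
    refine (Mem.empty hC).congr rfl rfl fun a b => ?_
    cases a <;> cases b <;> simp [Agree]
  | cons l P ih =>
    have h : Mem C [l.1] [l.1] (fun a b => ∃ x y, a = [x] ∧ b = [y] ∧ (l.2 = true → x = y)) := by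
      rcases l with ⟨c, _ | _⟩
      · exact (mem_disconnect hC hs c).congr rfl rfl fun a b => by simp
      · refine (Mem.id_single hC c).congr rfl rfl fun a b => ?_
        constructor
        · rintro ⟨x, rfl, rfl⟩; exact ⟨x, x, rfl, rfl, fun _ => rfl⟩
        · rintro ⟨x, y, rfl, rfl, hxy⟩
          obtain rfl := hxy rfl
          exact ⟨x, rfl, rfl⟩
    refine (h.tensor hC ih).congr rfl rfl fun a b => ?_
    constructor
    · rintro ⟨_, a, _, b, rfl, rfl, ⟨x, y, rfl, rfl, hxy⟩, hab⟩
      exact ⟨hxy, hab⟩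
    · intro hab
      cases a with
      | nil => exact hab.elim
      | cons x a =>
        cases b with
        | nil => exact hab.elim
        | cons y b => exact ⟨[x], a, [y], b, rfl, rfl, ⟨x, y, rfl, rfl, hab.1⟩, hab.2⟩

theorem psem_iff {P : Pat} {f : List Bool} :
    psem P f ↔ ∃ (hf : f.length = P.length) (ξ : Bool),
      ∀ i (hi : i < P.length), P[i].2 = true → f[i] = ξ := by
  unfold psem Fits
  simp only [List.forall₂_iff_get, List.get_eq_getElem]
  constructor
  · rintro ⟨ξ, h1, h2⟩
    exact ⟨h1.symm, ξ, fun i hi => h2 i hi (by omega)⟩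
  · rintro ⟨h1, ξ, h2⟩
    exact ⟨ξ, h1.symm, fun i hi _ => h2 i hi⟩

/-- Isolating all points of a lower partition except for some points of one block. -/
theorem LMem.restrict (hC : IsCategory C) (hs : singPair ∈ C) {P : Pat} {F : List Bool → Prop}
    (h : LMem C (cols P) F) (hconst : ∀ ξ, F (List.replicate P.length ξ))
    (hP : ∀ f (hf : f.length = P.length), F f → ∀ i j (hi : i < P.length) (hj : j < P.length),
      P[i].2 = true → P[j].2 = true → f[i] = f[j]) : PMem C P := by
  refine (h.apply hC (mem_agree hC hs P)).congr rfl fun f => ?_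
  simp only [agree_iff]
  rw [psem_iff]
  constructor
  · rintro ⟨g, hg, hl, hf, hgf⟩
    refine ⟨hf, ?_⟩
    by_cases hi : ∃ i, ∃ hi : i < P.length, P[i].2 = true
    · obtain ⟨i, hi, hPi⟩ := hi
      refine ⟨f[i], fun j hj hPj => ?_⟩
      rw [← hgf i hi hPi, ← hgf j hj hPj]
      exact hP g hl hg j i hj hi hPj hPi
    · push Not at hi
      exact ⟨true, fun j hj hPj => absurd hPj (hi j hj)⟩
  · rintro ⟨hf, ξ, hξ⟩
    exact ⟨_, hconst ξ, by simp, hf, fun i hi hPi => by simpa using (hξ i hi hPi).symm⟩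

theorem LMem.const {w : List Color} {F : List Bool → Prop} (h : LMem C w F) (ξ : Bool) :
    F (List.replicate w.length ξ) := by
  obtain ⟨p, -, hu, rfl, hp⟩ := h
  have h1 : sem p (List.replicate (upWord p).length ξ) (List.replicate (lowWord p).length ξ) := by
    refine ⟨fun _ => ξ, fun _ => ξ, by simp [upWord], by simp [lowWord], ?_⟩
    rintro (x | x) (y | y) - <;> rfl
  exact ((hp _ _).1 h1).2

theorem LMem.sing (hC : IsCategory C) (hs : singPair ∈ C) {w : List Color} {F : List Bool → Prop}
    (h : LMem C w F) : Sing C w := by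
  rw [← pMem_fr]
  refine LMem.restrict hC hs (F := F) (by simpa using h) (by simpa using h.const) ?_
  intro f hf _ i j hi hj hPi
  simp [fr] at hPi

theorem PMem.sing (hC : IsCategory C) (hs : singPair ∈ C) {P : Pat} (h : PMem C P) :
    Sing C (cols P) := LMem.sing hC hs h

/-- Isolating a point of the distinguished block. -/
theorem PMem.isolate (hC : IsCategory C) (hs : singPair ∈ C) {P Q : Pat} {l : Color × Bool}
    (h : PMem C (P ++ (l :: Q))) : PMem C (P ++ ((l.1, false) :: Q)) := by
  refine LMem.restrict hC hs (F := psem (P ++ (l :: Q))) (LMem.congr h (by simp) fun _ => Iff.rfl)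
    (fun ξ => ⟨ξ, by simpa using fits_replicate ξ (P ++ (l :: Q))⟩) ?_
  intro f hf hpf i j hi hj hPi hPj
  obtain ⟨hl, ξ, hξ⟩ := psem_iff.1 hpf
  have key : ∀ k (hk : k < (P ++ ((l.1, false) :: Q)).length),
      (P ++ ((l.1, false) :: Q))[k].2 = true → f[k] = ξ := by
    intro k hk hPk
    refine hξ k (by simpa using hk) ?_
    rw [List.getElem_append] at hPk ⊢
    split_ifs at hPk ⊢ with h1
    · exact hPk
    · rw [List.getElem_cons] at hPk ⊢
      split_ifs at hPk ⊢
      exact hPk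
  rw [key i hi hPi, key j hj hPj]

end Singletons

/-! ### Partitions given by patterns, and blocks with three points -/

section Patterns

variable {C : Set TCP}

theorem sem_mkLower_pattern {n : ℕ} (color : Fin n → Color) {lbl : Fin n → ℕ} {flag : Fin n → Bool}
    (h : ∀ i j, lbl i = lbl j ↔ i = j ∨ flag i = true ∧ flag j = true) (a b : List Bool) :
    sem (mkLower n color lbl) a b ↔ a = [] ∧ psem (List.ofFn fun j => (color j, flag j)) b := by
  rw [sem_mkLower, psem_iff]
  refine and_congr_right fun _ => ?_
  constructor
  · rintro ⟨g, rfl, hg⟩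
    refine ⟨by simp, ?_⟩
    by_cases hi : ∃ i, flag i = true
    · obtain ⟨i, hi⟩ := hi
      exact ⟨g i, fun j hj hPj => by simpa using hg _ _ ((h _ _).2 (Or.inr ⟨by simpa using hPj, hi⟩))⟩
    · push Not at hi
      exact ⟨true, fun j hj hPj => absurd (by simpa using hPj) (hi _)⟩
  · rintro ⟨hl, ξ, hξ⟩
    have hl : b.length = n := by simpa using hl
    subst hl
    refine ⟨b.get, (List.ofFn_get b).symm, fun i j hij => ?_⟩
    rcases (h i j).1 hij with rfl | ⟨hi, hj⟩
    · rfl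
    · have h1 := hξ i (by simp) (by simpa using hi)
      have h2 := hξ j (by simp) (by simpa using hj)
      rw [List.get_eq_getElem, List.get_eq_getElem, h1, h2]

theorem lowWord_mkLower {n : ℕ} (color : Fin n → Color) (lbl : Fin n → ℕ) (flag : Fin n → Bool) :
    lowWord (mkLower n color lbl) = cols (List.ofFn fun j => (color j, flag j)) := by
  simp [lowWord, cols, mkLower, Function.comp_def]

theorem mkLower_mem_iff {n : ℕ} (color : Fin n → Color) {lbl : Fin n → ℕ} {flag : Fin n → Bool}
    (h : ∀ i j, lbl i = lbl j ↔ i = j ∨ flag i = true ∧ flag j = true) :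
    mkLower n color lbl ∈ C ↔ PMem C (List.ofFn fun j => (color j, flag j)) := by
  rw [mem_iff_mem_sem]
  exact ⟨fun hm => hm.congr rfl (lowWord_mkLower color lbl flag) (sem_mkLower_pattern color h),
    fun hm => Mem.congr hm rfl (lowWord_mkLower color lbl flag).symm
      fun a b => (sem_mkLower_pattern color h a b).symm⟩

theorem PMem.fourWBWB_mem (hC : IsCategory C) (c : Color)
    (h : PMem C [(c, true), (!c, true), (c, true), (!c, true)]) : fourWBWB ∈ C := by
  have h1 : PMem C [(white, true), (black, true), (white, true), (black, true)] := by
    cases c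
    · exact PMem.rotate hC (P := [(false, true)]) (Q := [(true, true), (false, true), (true, true)]) h
    · exact h
  rw [fourWBWB, fourBlock, mkLower_mem_iff (flag := fun _ => true) _ (by simp)]
  simpa using h1

/-- A block with at least three points gives rise to the four-block. -/
theorem PMem.fourWBWB_mem_of_triple (hC : IsCategory C) (hs : singPair ∈ C)
    {A U V B : List Color} {x y z : Color}
    (h : PMem C (fr A ++ ((x, true) :: (fr U ++ ((y, true) :: (fr V ++ ((z, true) :: fr B))))))) :
    fourWBWB ∈ C := by
  have h1 := h.rotate hC
  have h2 : PMem C (fr (winv (B ++ A)) ++ ((!z, true) :: (fr (winv V) ++ ((!y, true) ::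
      (fr (winv U) ++ [(!x, true)]))))) := by
    simpa [pinv_append, pinv_cons, pinv_nil, pinv_fr, winv_append] using h1.reflect hC
  have h3 := h2.rotate hC
  have h4 : PMem C (((x, true) :: (fr U ++ ((y, true) :: fr V))) ++ ((z, true) :: fr (B ++ A))) := by
    simpa using h1
  have h5 : PMem C (((x, true) :: (fr U ++ [(y, true)])) ++ (fr (V ++ winv V) ++ ((!y, true) ::
      (fr (winv U) ++ ((!x, true) :: (fr (winv (B ++ A) ++ (B ++ A)))))))) := by
    simpa using h4.join hC h3
  have h6 := h5.remove_sing hC (sing_of_csum_eq_zero hC hs (by simp))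
  have h7 : PMem C (((x, true) :: (fr U ++ ((y, true) :: (!y, true) ::
      (fr (winv U) ++ [(!x, true)])))) ++ (fr (winv (B ++ A) ++ (B ++ A)) ++ [])) := by
    simpa using h6
  have h8 := h7.remove_sing hC (sing_of_csum_eq_zero hC hs (by simp))
  have h9 : PMem C (((x, true) :: fr U) ++ ((y, true) :: (!y, true) ::
      (fr (winv U) ++ [(!x, true)]))) := by simpa using h8
  have h10 : PMem C (((y, true) :: (!y, true) :: (fr (winv U) ++ [(!x, true)])) ++
      ((x, true) :: fr U)) := h9.rotate hC
  have h11 : PMem C (((x, true) :: (fr U ++ ((y, true) :: (!y, true) :: fr (winv U)))) ++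
      [(!x, true)]) := by simpa using h9
  have h12 := h10.join hC (h11.rotate hC)
  have h13 : PMem C (((y, true) :: (!y, true) :: fr (winv U)) ++ ((!x, true) ::
      ((x, true) :: (fr U ++ ((y, true) :: (!y, true) :: fr (winv U ++ U)))))) := by
    simpa using h12
  have h14 : PMem C (((y, true) :: (!y, true) :: (fr (winv U) ++ [(!x, false)])) ++ ((x, true) ::
      (fr U ++ ((y, true) :: (!y, true) :: fr (winv U ++ U))))) := by
    simpa using h13.isolate hC hs
  have h15 : PMem C ([(y, true), (!y, true)] ++ (fr (winv U ++ ((!x) :: x :: U)) ++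
      ((y, true) :: (!y, true) :: fr (winv U ++ U)))) := by
    simpa using h14.isolate hC hs
  have h16 := h15.remove_sing hC (sing_of_csum_eq_zero hC hs (by simp))
  have h17 : PMem C ([(y, true), (!y, true), (y, true), (!y, true)] ++ (fr (winv U ++ U) ++ [])) := by
    simpa using h16
  have h18 := h17.remove_sing hC (sing_of_csum_eq_zero hC hs (by simp))
  exact PMem.fourWBWB_mem hC y (by simpa using h18)

end Patterns

/-! ### Links: two-point blocks among singletons -/

section Links

variable {C : Set TCP}

/-- `C` contains a partition with a single two-point block, with end points of colors `x` and `y`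
enclosing singletons whose colors sum up to `m`, and with singletons elsewhere. -/
def Link (C : Set TCP) (x y : Color) (m : ℤ) : Prop :=
  ∃ A W B, csum W = m ∧ PMem C (fr A ++ ((x, true) :: (fr W ++ ((y, true) :: fr B))))

theorem Link.pMem (hC : IsCategory C) (hs : singPair ∈ C) {x y : Color} {m : ℤ}
    (h : Link C x y m) {A W B : List Color} (hW : csum W - m ∈ degreeSubgroup hC)
    (hsum : csum A + sgn x + csum W + sgn y + csum B ∈ degreeSubgroup hC) :
    PMem C (fr A ++ ((x, true) :: (fr W ++ ((y, true) :: fr B)))) := by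
  obtain ⟨A₀, W₀, B₀, rfl, h⟩ := h
  have h0 := (sing_iff hC hs).1 (h.sing hC hs)
  have h1 : PMem C ([(x, true)] ++ (fr W₀ ++ ((y, true) :: fr (B₀ ++ A₀)))) := by
    simpa using h.rotate hC
  have h2 : PMem C (((x, true) :: (fr W ++ [(y, true)])) ++ (fr (B₀ ++ A₀) ++ [])) := by
    simpa using h1.replace_sing hC hs hW
  have h3 : csum (B ++ A) - csum (B₀ ++ A₀) ∈ degreeSubgroup hC := by
    convert sub_mem (sub_mem hsum h0) hW using 1
    simp
    ring
  have h4 : PMem C (((x, true) :: (fr W ++ ((y, true) :: fr B))) ++ fr A) := by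
    simpa using h2.replace_sing hC hs h3
  exact h4.rotate hC

theorem Link.symm (hC : IsCategory C) (hs : singPair ∈ C) {x y : Color} {m : ℤ}
    (h : Link C x y m) : Link C y x (-m - sgn x - sgn y) := by
  obtain ⟨W, hW⟩ := exists_csum_eq m
  obtain ⟨B, hB⟩ := exists_csum_eq (-m - sgn x - sgn y)
  have h1 := h.pMem hC hs (A := []) (W := W) (B := B) (by simp [hW])
    (by rw [hW, hB]; convert (degreeSubgroup hC).zero_mem using 1; simp; ring)
  have h2 : PMem C (((x, true) :: fr W) ++ ((y, true) :: fr B)) := by simpa using h1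
  exact ⟨[], B, W, hB, by simpa using h2.rotate hC⟩

theorem Link.reflect (hC : IsCategory C) {x y : Color} {m : ℤ}
    (h : Link C x y m) : Link C (!y) (!x) (-m) := by
  obtain ⟨A, W, B, rfl, h⟩ := h
  refine ⟨winv B, winv W, winv A, by simp, ?_⟩
  simpa [pinv_append, pinv_cons, pinv_nil, pinv_fr] using h.reflect hC

theorem Link.join (hC : IsCategory C) (hs : singPair ∈ C) {x y z : Color} {m n : ℤ}
    (h : Link C x y m) (h' : Link C (!y) z n) : Link C x z (m + n) := by
  obtain ⟨A, W, B, rfl, h⟩ := h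
  obtain ⟨V, rfl⟩ := exists_csum_eq n
  obtain ⟨T, hT⟩ := exists_csum_eq (-csum V - sgn (!y) - sgn z)
  have h1 := h'.pMem hC hs (A := []) (W := V) (B := T) (by simp) (by simp [hT])
  have h2 : PMem C ((fr A ++ ((x, true) :: fr W)) ++ ((y, true) :: fr B)) := by simpa using h
  have h3 := h2.join hC (by simpa using h1)
  exact ⟨A, W ++ V, T ++ B, by simp, by simpa using h3⟩

theorem Link.white_black_neg (hC : IsCategory C) {m : ℤ}
    (h : Link C white black m) : Link C white black (-m) := h.reflect hC

/-- The subgroup of the degrees of links with end points of different colors. -/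
def linkSubgroup (hC : IsCategory C) (hs : singPair ∈ C) : AddSubgroup ℤ where
  carrier := {m | Link C white black m}
  zero_mem' := ⟨[], [], [], rfl, PMem.pair white hC⟩
  add_mem' := fun h h' => Link.join hC hs (y := black) h h'
  neg_mem' := fun h => h.white_black_neg hC

theorem mem_linkSubgroup (hC : IsCategory C) (hs : singPair ∈ C) {m : ℤ} :
    m ∈ linkSubgroup hC hs ↔ Link C white black m := Iff.rfl

theorem link_black_white (hC : IsCategory C) (hs : singPair ∈ C) {m : ℤ} :
    Link C black white m ↔ m ∈ linkSubgroup hC hs := by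
  rw [mem_linkSubgroup]
  constructor
  · intro h
    have h1 : Link C white black (-m) := by
      have := h.symm hC hs
      simpa [white, black, sgn] using this
    simpa using h1.white_black_neg hC
  · intro h
    have h1 : Link C black white (-m - 1 + 1) := by
      have := h.symm hC hs
      simpa [white, black, sgn] using this
    have := h1.reflect hC
    simpa [white, black] using this

theorem link_black_black (hC : IsCategory C) {m : ℤ} :
    Link C black black m ↔ Link C white white (-m) :=
  ⟨fun h => h.reflect hC, fun h => by simpa [white, black] using h.reflect hC⟩

theorem Link.white_white_add (hC : IsCategory C) (hs : singPair ∈ C) {m n : ℤ}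
    (h : Link C white white m) (hn : n ∈ linkSubgroup hC hs) : Link C white white (m + n) :=
  h.join hC hs (y := white) ((link_black_white hC hs).2 hn)

theorem Link.white_white_sub (hC : IsCategory C) (hs : singPair ∈ C) {m n : ℤ}
    (h : Link C white white m) (h' : Link C white white n) : m - n ∈ linkSubgroup hC hs :=
  h.join hC hs (y := white) (h'.reflect hC)

theorem Link.white_white_symm (hC : IsCategory C) (hs : singPair ∈ C) {m : ℤ}
    (h : Link C white white m) : Link C white white (-2 - m) := by
  convert h.symm hC hs using 1
  simp [white, sgn]
  ring

theorem degreeSubgroup_le_linkSubgroup (hC : IsCategory C) (hs : singPair ∈ C) :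
    degreeSubgroup hC ≤ linkSubgroup hC hs := by
  intro n hn
  obtain ⟨W, hW⟩ := exists_csum_eq n
  have h0 : Link C white black 0 := (linkSubgroup hC hs).zero_mem
  exact ⟨[], W, [], hW, h0.pMem hC hs (by simpa [hW] using hn)
    (by simpa [hW, white, black, sgn] using hn)⟩

end Links

/-! ### Transferring partitions between categories -/

section Transfer

variable {C : Set TCP}

theorem lMem_of_mem {p : TCP} (hp : p ∈ C) (hk : p.k = 0) : LMem C (lowWord p) (sem p []) := by
  have hu : upWord p = [] := List.eq_nil_of_length_eq_zero (by simp [upWord, hk])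
  refine (mem_iff_mem_sem.1 hp).congr hu rfl fun a b => ?_
  constructor
  · intro h
    have ha : a = [] := List.eq_nil_of_length_eq_zero (by simpa [hu] using h.length_up)
    subst ha
    exact ⟨rfl, h⟩
  · rintro ⟨rfl, h⟩
    exact h

theorem sem_nil_iff {p : TCP} (hk : p.k = 0) {f : List Bool} :
    sem p [] f ↔ ∃ g : Fin p.l → Bool, f = List.ofFn g ∧
      ∀ i j, p.rel.r (Sum.inr i) (Sum.inr j) → g i = g j := by
  constructor
  · rintro ⟨_, g, -, rfl, h⟩
    exact ⟨g, rfl, fun i j hij => h _ _ hij⟩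
  · rintro ⟨g, rfl, h⟩
    refine ⟨fun _ => true, g, ?_, rfl, ?_⟩
    · exact (List.eq_nil_of_length_eq_zero (by simp [hk])).symm
    · rintro (i | i) (j | j) hij
      · exact (Fin.cast hk i).elim0
      · exact (Fin.cast hk i).elim0
      · exact (Fin.cast hk j).elim0
      · exact h i j hij

theorem pMem_of_rel (hC : IsCategory C) (hs : singPair ∈ C) {p : TCP} (hp : p ∈ C) (hk : p.k = 0)
    {P : Pat} (hw : lowWord p = cols P)
    (hrel : ∀ i j : Fin p.l, (∃ c, P[i.1]? = some (c, true)) → (∃ c, P[j.1]? = some (c, true)) →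
      p.rel.r (Sum.inr i) (Sum.inr j)) : PMem C P := by
  have h := lMem_of_mem hp hk
  rw [hw] at h
  have hl : p.l = P.length := by simpa [lowWord] using congrArg List.length hw
  refine LMem.restrict hC hs h (fun ξ => by simpa using h.const ξ) ?_
  intro f hf hsem i j hi hj hPi hPj
  obtain ⟨g, rfl, hg⟩ := (sem_nil_iff hk).1 hsem
  simp only [List.getElem_ofFn]
  refine hg _ _ (hrel _ _ ⟨P[i].1, ?_⟩ ⟨P[j].1, ?_⟩)
  · simp [hi, ← hPi]
  · simp [hj, ← hPj]

theorem flag_cases {A : List Color} {l : Color × Bool} {Q : Pat} {k : ℕ} {d : Color}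
    (h : (fr A ++ (l :: Q))[k]? = some (d, true)) :
    k = A.length ∨ ∃ k', k = A.length + 1 + k' ∧ Q[k']? = some (d, true) := by
  rcases lt_trichotomy k A.length with hk | hk | hk
  · rw [List.getElem?_append_left (by simpa using hk)] at h
    simp [fr] at h
  · exact Or.inl hk
  · obtain ⟨k', rfl⟩ := Nat.exists_eq_add_of_lt hk
    refine Or.inr ⟨k', by ring, ?_⟩
    rw [List.getElem?_append_right (by simp; omega)] at h
    have : A.length + k' + 1 - (fr A).length = k' + 1 := by simp; omega
    rw [this] at h
    simpa using h

theorem not_flag_fr {A : List Color} {k : ℕ} {d : Color} : (fr A)[k]? ≠ some (d, true) := by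
  simp [fr]

theorem exists_split (w : List Color) {i j : ℕ} (hij : i < j) (hj : j < w.length) :
    ∃ A x W y B, w = A ++ (x :: (W ++ (y :: B))) ∧ A.length = i ∧ A.length + 1 + W.length = j := by
  refine ⟨w.take i, w[i], (w.drop (i + 1)).take (j - i - 1), w[j], w.drop (j + 1), ?_, ?_, ?_⟩
  · have h1 : w.drop (i + 1) = (w.drop (i + 1)).take (j - i - 1) ++ (w[j] :: w.drop (j + 1)) := by
      conv_lhs => rw [← List.take_append_drop (j - i - 1) (w.drop (i + 1))]
      rw [List.drop_drop, show i + 1 + (j - i - 1) = j by omega, List.drop_eq_getElem_cons hj]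
    rw [← h1, List.getElem_cons_drop, List.take_append_drop]
  · simp; omega
  · simp; omega

/-- In a category without the four-block, blocks have at most two points. -/
theorem not_rel_of_lt_of_lt (hC : IsCategory C) (hs : singPair ∈ C) (hf : fourWBWB ∉ C) {p : TCP}
    (hp : p ∈ C) (hk : p.k = 0) {i j m : Fin p.l} (hij : i < j) (hjm : j < m)
    (h : p.rel.r (Sum.inr i) (Sum.inr j)) : ¬ p.rel.r (Sum.inr j) (Sum.inr m) := by
  intro h'
  obtain ⟨A, x, W, y, B, hw, hA, hW⟩ := exists_split (lowWord p) (i := i) (j := j) hij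
    (by simp [lowWord])
  have hlen : p.l = A.length + 1 + W.length + 1 + B.length := by
    have := congrArg List.length hw
    simp [lowWord] at this
    omega
  have hB : ∃ V z T, B = V ++ (z :: T) ∧ A.length + 1 + W.length + 1 + V.length = m := by
    have hm := m.2
    have hlt : m.1 - j.1 - 1 < B.length := by omega
    refine ⟨B.take (m - j - 1), B[m.1 - j.1 - 1], B.drop (m - j - 1 + 1), ?_, ?_⟩
    · rw [List.getElem_cons_drop, List.take_append_drop]
    · simp; omega
  obtain ⟨V, z, T, rfl, hV⟩ := hB
  refine hf (PMem.fourWBWB_mem_of_triple hC hs (A := A) (U := W) (V := V) (B := T) (x := x) (y := y)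
    (z := z) (pMem_of_rel hC hs hp hk (by simpa using hw) ?_))
  have key : ∀ a : Fin p.l, (∃ c, (fr A ++ ((x, true) :: (fr W ++ ((y, true) ::
      (fr V ++ ((z, true) :: fr T))))))[a.1]? = some (c, true)) →
      p.rel.r (Sum.inr j) (Sum.inr a) := by
    rintro a ⟨c, hc⟩
    rcases flag_cases hc with ha | ⟨k, ha, hc⟩
    · obtain rfl : a = i := Fin.ext (by omega)
      exact p.rel.symm h
    rcases flag_cases hc with hk' | ⟨k', hk', hc⟩
    · obtain rfl : a = j := Fin.ext (by omega)
      exact p.rel.refl _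
    rcases flag_cases hc with hk' | ⟨k', hk', hc⟩
    · obtain rfl : a = m := Fin.ext (by omega)
      exact h'
    exact (not_flag_fr hc).elim
  exact fun a b ha hb => p.rel.trans (p.rel.symm (key a ha)) (key b hb)

theorem link_of_rel (hC : IsCategory C) (hs : singPair ∈ C) {p : TCP} (hp : p ∈ C) (hk : p.k = 0)
    {i j : Fin p.l} (h : p.rel.r (Sum.inr i) (Sum.inr j)) {A W B : List Color} {x y : Color}
    (hw : lowWord p = A ++ (x :: (W ++ (y :: B)))) (hA : A.length = i)
    (hW : A.length + 1 + W.length = j) : Link C x y (csum W) := by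
  refine ⟨A, W, B, rfl, pMem_of_rel hC hs hp hk (by simpa using hw) ?_⟩
  have key : ∀ a : Fin p.l, (∃ c, (fr A ++ ((x, true) :: (fr W ++ ((y, true) :: fr B))))[a.1]? =
      some (c, true)) → p.rel.r (Sum.inr i) (Sum.inr a) := by
    rintro a ⟨c, hc⟩
    rcases flag_cases hc with ha | ⟨k, ha, hc⟩
    · obtain rfl : a = i := Fin.ext (by omega)
      exact p.rel.refl _
    rcases flag_cases hc with hk' | ⟨k', hk', hc⟩
    · obtain rfl : a = j := Fin.ext (by omega)
      exact h
    exact (not_flag_fr hc).elim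
  exact fun a b ha hb => p.rel.trans (p.rel.symm (key a ha)) (key b hb)

/-- Replacing a segment of singletons. -/
theorem LMem.replace_segment (hC : IsCategory C) {A S V B : List Color}
    {F : List Bool → List Bool → Prop} {G : List Bool → Prop}
    (h : LMem C (A ++ (S ++ B)) (fun f => ∃ a s b, f = a ++ (s ++ b) ∧ a.length = A.length ∧
      s.length = S.length ∧ b.length = B.length ∧ F a b))
    (hG : LMem C (S ++ V) (fun f => ∃ s v, f = s ++ v ∧ s.length = S.length ∧
      v.length = V.length ∧ G s)) (hV : Sing C (V ++ S)) :
    LMem C (A ++ (S ++ B)) (fun f => ∃ a s b, f = a ++ (s ++ b) ∧ a.length = A.length ∧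
      s.length = S.length ∧ b.length = B.length ∧ F a b ∧ G s) := by
  have h1 := h.insert hC hG
  have h2 := LMem.remove hC (A := A ++ S) (V := V ++ S) (B := B)
    (h1.congr (by simp) fun _ => Iff.rfl) hV
  refine h2.congr (by simp) fun f => ?_
  constructor
  · rintro ⟨t, v, b, rfl, ht, hb, ⟨a, u, b', he, ha, hb', ⟨a₀, s₀, b₀, he₀, ha₀, hs₀, hb₀, hF⟩,
      s, v', rfl, hs, hv', hGs⟩, hv⟩
    obtain ⟨rfl, rfl⟩ := List.append_inj he₀ (by omega)
    simp only [List.append_assoc] at he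
    rw [← List.append_assoc a s] at he
    obtain ⟨rfl, he₁⟩ := List.append_inj he (by simp at ht ⊢; omega)
    rw [← List.append_assoc v'] at he₁
    obtain ⟨-, rfl⟩ := List.append_inj he₁ (by simp at hv ⊢; omega)
    exact ⟨a, s, b, by simp, ha, hs, hb, hF, hGs⟩
  · rintro ⟨a, s, b, rfl, ha, hs, hb, hF, hGs⟩
    refine ⟨a ++ s, List.replicate V.length true ++ s, b, by simp, by simp [ha, hs], hb,
      ⟨a, s ++ List.replicate V.length true, s ++ b, by simp, ha, by simp [hs, hb],
        ⟨a, s, b, rfl, ha, hs, hb, hF⟩, s, _, rfl, hs, by simp, hGs⟩, by simp [hs]⟩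

end Transfer

section Inclusion

variable {C D : Set TCP}

theorem sem_nil_iff_getElem? {p : TCP} (hk : p.k = 0) {f : List Bool} :
    sem p [] f ↔ f.length = p.l ∧
      ∀ i j : Fin p.l, p.rel.r (Sum.inr i) (Sum.inr j) → f[i.1]? = f[j.1]? := by
  rw [sem_nil_iff hk]
  constructor
  · rintro ⟨g, rfl, h⟩
    refine ⟨by simp, fun i j hij => ?_⟩
    simpa using h i j hij
  · rintro ⟨hl, h⟩
    refine ⟨fun i => f[i.1], ?_, fun i j hij => ?_⟩
    · refine List.ext_getElem (by simp [hl]) fun i h1 h2 => by simp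
    · have := h i j hij
      rwa [List.getElem?_eq_getElem (by omega), List.getElem?_eq_getElem (by omega),
        Option.some_inj] at this

theorem not_rel_triple (hC : IsCategory C) (hs : singPair ∈ C) (hf : fourWBWB ∉ C) {p : TCP}
    (hp : p ∈ C) (hk : p.k = 0) {a b c : Fin p.l} (hab : p.rel.r (Sum.inr a) (Sum.inr b))
    (hac : p.rel.r (Sum.inr a) (Sum.inr c)) (h1 : a ≠ b) (h2 : a ≠ c) (h3 : b ≠ c) : False := by
  have hbc := p.rel.trans (p.rel.symm hab) hac
  have hba := p.rel.symm hab
  have hca := p.rel.symm hac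
  have hcb := p.rel.symm hbc
  have key := fun {i j m : Fin p.l} => not_rel_of_lt_of_lt hC hs hf hp hk (i := i) (j := j) (m := m)
  rcases lt_or_gt_of_ne h1 with h1 | h1 <;> rcases lt_or_gt_of_ne h2 with h2 | h2 <;>
    rcases lt_or_gt_of_ne h3 with h3 | h3
  · exact key h1 h3 hab hbc
  · exact key h2 h3 hac hcb
  · exact absurd (h1.trans h3) h2.asymm
  · exact key h2 h1 hca hab
  · exact key h1 h2 hba hac
  · exact absurd (h2.trans h3) h1.asymm
  · exact key h3 h2 hbc hca
  · exact key h3 h1 hcb hba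

/-- A shortest link encloses singletons only. -/
theorem rel_cases_of_innermost (hC : IsCategory C) (hs : singPair ∈ C) (hf : fourWBWB ∉ C)
    {p : TCP} (hp : p ∈ C) (hNC : Noncrossing p) (hk : p.k = 0) {i j : Fin p.l} (hij : i < j)
    (hr : p.rel.r (Sum.inr i) (Sum.inr j))
    (hmin : ∀ a b : Fin p.l, a < b → p.rel.r (Sum.inr a) (Sum.inr b) → j.1 - i.1 ≤ b.1 - a.1)
    {s t : Fin p.l} (h1 : i ≤ s) (h2 : s ≤ j) (hst : p.rel.r (Sum.inr s) (Sum.inr t)) :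
    s = t ∨ (s = i ∧ t = j) ∨ (s = j ∧ t = i) := by
  have triple := fun {a b c : Fin p.l} => not_rel_triple hC hs hf hp hk (a := a) (b := b) (c := c)
  have pos : ∀ a b : Fin p.l, a < b → linePos p (Sum.inr a) < linePos p (Sum.inr b) :=
    fun a b hab => Nat.add_lt_add_left hab _
  have hrs := p.rel.symm hr
  have hts := p.rel.symm hst
  by_contra! hcon
  obtain ⟨hne, hn1, hn2⟩ := hcon
  rcases eq_or_lt_of_le h1 with rfl | h1
  · exact triple hr hst hij.ne hne (fun h => hn1 rfl h.symm)
  rcases eq_or_lt_of_le h2 with rfl | h2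
  · exact triple hrs hst hij.ne' hne (fun h => hn2 rfl h.symm)
  rcases lt_trichotomy t i with ht | rfl | ht
  · have h3 := hNC _ _ _ _ (pos _ _ ht) (pos _ _ h1) (pos _ _ h2) hts hr
    exact triple h3 hts ht.ne (ht.trans h1).ne h1.ne
  · exact triple hts hr h1.ne hij.ne h2.ne
  rcases lt_trichotomy t j with ht' | rfl | ht'
  · rcases lt_or_gt_of_ne hne with h3 | h3
    · have := hmin s t h3 hst
      omega
    · have := hmin t s h3 hts
      omega
  · exact triple hts hrs h2.ne' hij.ne' h1.ne'
  · have h3 := hNC _ _ _ _ (pos _ _ h1) (pos _ _ h2) (pos _ _ ht') hr hst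
    exact triple h3 hr h1.ne hij.ne h2.ne

theorem exists_innermost (p : TCP)
    (h : ∃ i j : Fin p.l, i < j ∧ p.rel.r (Sum.inr i) (Sum.inr j)) :
    ∃ i j : Fin p.l, i < j ∧ p.rel.r (Sum.inr i) (Sum.inr j) ∧
      ∀ a b : Fin p.l, a < b → p.rel.r (Sum.inr a) (Sum.inr b) → j.1 - i.1 ≤ b.1 - a.1 := by
  classical
  have hex : ∃ n, ∃ i j : Fin p.l, i < j ∧ p.rel.r (Sum.inr i) (Sum.inr j) ∧ j.1 - i.1 = n := by
    obtain ⟨i, j, hij, hr⟩ := h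
    exact ⟨_, i, j, hij, hr, rfl⟩
  obtain ⟨i, j, hij, hr, hn⟩ := Nat.find_spec hex
  exact ⟨i, j, hij, hr, fun a b hab hab' => hn ▸ Nat.find_min' hex ⟨a, b, hab, hab', rfl⟩⟩

theorem sem_of_innermost (hC : IsCategory C) (hs : singPair ∈ C) (hf : fourWBWB ∉ C)
    {p : TCP} (hp : p ∈ C) (hNC : Noncrossing p) (hk : p.k = 0) {i j : Fin p.l} (hij : i < j)
    (hr : p.rel.r (Sum.inr i) (Sum.inr j))
    (hmin : ∀ a b : Fin p.l, a < b → p.rel.r (Sum.inr a) (Sum.inr b) → j.1 - i.1 ≤ b.1 - a.1)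
    {a s b u : List Bool} {ξ : Bool} (ha : a.length = i) (hsu : s.length = u.length + 2)
    (hu : i.1 + 1 + u.length = j) (h : sem p [] (a ++ (s ++ b))) :
    sem p [] (a ++ ((ξ :: (u ++ [ξ])) ++ b)) := by
  rw [sem_nil_iff_getElem? hk] at h ⊢
  obtain ⟨hl, h⟩ := h
  obtain ⟨m, hm⟩ : ∃ m, m = ξ :: (u ++ [ξ]) := ⟨_, rfl⟩
  have hml : m.length = u.length + 2 := by simp [hm]
  have hmi : m[0]? = some ξ := by simp [hm]
  have hmj : m[u.length + 1]? = some ξ := by simp [hm]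
  rw [← hm]
  simp only [List.length_append] at hl ⊢
  refine ⟨by omega, ?_⟩
  have out : ∀ t : Fin p.l, t < i ∨ j < t → (a ++ (m ++ b))[t.1]? = (a ++ (s ++ b))[t.1]? := by
    rintro t (ht | ht)
    · rw [List.getElem?_append_left (by omega), List.getElem?_append_left (by omega)]
    · rw [List.getElem?_append_right (by omega), List.getElem?_append_right (by omega),
        List.getElem?_append_right (by omega), List.getElem?_append_right (by omega), hml, hsu]
  have ends : (a ++ (m ++ b))[i.1]? = (a ++ (m ++ b))[j.1]? := by
    rw [List.getElem?_append_right (by omega), List.getElem?_append_left (by omega),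
      List.getElem?_append_right (by omega), List.getElem?_append_left (by omega),
      show i.1 - a.length = 0 by omega, show j.1 - a.length = u.length + 1 by omega, hmi, hmj]
  have inner := fun {s t : Fin p.l} =>
    rel_cases_of_innermost hC hs hf hp hNC hk hij hr hmin (s := s) (t := t)
  intro s t hst
  by_cases h1 : i ≤ s ∧ s ≤ j
  · rcases inner h1.1 h1.2 hst with rfl | ⟨rfl, rfl⟩ | ⟨rfl, rfl⟩
    · rfl
    · exact ends
    · exact ends.symm
  by_cases h2 : i ≤ t ∧ t ≤ j
  · rcases inner h2.1 h2.2 (p.rel.symm hst) with rfl | ⟨rfl, rfl⟩ | ⟨rfl, rfl⟩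
    · rfl
    · exact ends.symm
    · exact ends
  · rw [out s (by by_contra! h3; exact h1 h3), out t (by by_contra! h3; exact h2 h3)]
    exact h s t hst

theorem Link.lMem (hC : IsCategory C) (hs : singPair ∈ C) {x y : Color} {U V : List Color}
    (h : Link C x y (csum U)) (hV : csum V = -csum (x :: (U ++ [y]))) :
    LMem C ((x :: (U ++ [y])) ++ V) (fun f => ∃ s v, f = s ++ v ∧
      s.length = (x :: (U ++ [y])).length ∧ v.length = V.length ∧
      ∃ ξ u, s = ξ :: (u ++ [ξ])) := by
  have h1 := h.pMem hC hs (A := []) (W := U) (B := V) (by simp)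
    (by rw [hV]; convert (degreeSubgroup hC).zero_mem using 1; simp; ring)
  refine LMem.congr h1 (by simp) fun f => ?_
  simp only [psem, fr_nil, List.nil_append, fits_cons_iff, fits_append_iff, fits_fr]
  constructor
  · rintro ⟨ξ, _, _, rfl, hξ, u, _, rfl, hu, _, v, rfl, hξ', hv⟩
    obtain rfl := hξ trivial
    obtain rfl := hξ' trivial
    exact ⟨_, v, (List.append_assoc (_ :: u) [_] v).symm, by simp [hu], hv, _, u, rfl⟩
  · rintro ⟨_, v, rfl, hl, hv, ξ, u, rfl⟩
    exact ⟨ξ, ξ, u ++ (ξ :: v), by simp, fun _ => rfl, u, ξ :: v, rfl, by simpa using hl, ξ, v, rfl,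
      fun _ => rfl, hv⟩

/-- A noncrossing partition with blocks of size at most two is determined by its links. -/
theorem LMem.transfer (hC : IsCategory C) (hD : IsCategory D) (hs : singPair ∈ C)
    (hs' : singPair ∈ D) (hf : fourWBWB ∉ C) (hNC : ∀ p ∈ C, Noncrossing p)
    (hdeg : degreeSubgroup hC ≤ degreeSubgroup hD)
    (hlink : ∀ x y m, Link C x y m → Link D x y m) {w : List Color} {F : List Bool → Prop}
    (h : LMem C w F) : LMem D w F := by
  induction hn : {f : List Bool | f.length = w.length ∧ ¬ F f}.ncard using
    Nat.strong_induction_on generalizing w F with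
  | _ n ih =>
    have hsing := (sing_iff hD hs').2 (hdeg ((sing_iff hC hs).1 (h.sing hC hs)))
    obtain ⟨p, hp, hu, rfl, hpF⟩ := id h
    have hk : p.k = 0 := by simpa [upWord] using congrArg List.length hu
    have hF : ∀ f, F f ↔ sem p [] f := fun f => by simp [hpF]
    by_cases hex : ∃ i j : Fin p.l, i < j ∧ p.rel.r (Sum.inr i) (Sum.inr j)
    · obtain ⟨i, j, hij, hr, hmin⟩ := exists_innermost p hex
      obtain ⟨A, x, U, y, B, hw, hA, hU⟩ := exists_split (lowWord p) (i := i) (j := j) hij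
        (by simp [lowWord])
      have hl := link_of_rel hC hs hp hk hr hw hA hU
      have inner := fun {a s b u : List Bool} {ξ : Bool} => sem_of_innermost hC hs hf hp
        (hNC p hp) hk hij hr hmin (a := a) (s := s) (b := b) (u := u) (ξ := ξ)
      simp only [← hF] at inner
      have hfi : ∀ f, F f → f[i.1]? = f[j.1]? := fun f hf =>
        ((sem_nil_iff_getElem? hk).1 ((hF f).1 hf)).2 i j hr
      have hw' : lowWord p = A ++ ((x :: (U ++ [y])) ++ B) := by simp [hw]
      have hT : ∀ a s b : List Bool, a.length = A.length → s.length = (x :: (U ++ [y])).length →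
          F (a ++ (s ++ b)) → F (a ++ ((true :: (List.replicate U.length true ++ [true])) ++ b)) :=
        fun a s b ha hsl h => inner (by omega) (by simpa using hsl) (by simp; omega) h
      have h1 := h.apply hC (Mem.congr (v' := lowWord p)
        (Mem.whisker hC A B (mem_agree hC hs (fr (x :: (U ++ [y]))))) (by rw [hw', cols_fr]) (by rw [hw', cols_fr]) fun _ _ => Iff.rfl)
      have h2 : LMem C (lowWord p) (fun f => ∃ a s b, f = a ++ (s ++ b) ∧ a.length = A.length ∧
          s.length = (x :: (U ++ [y])).length ∧ b.length = B.length ∧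
          F (a ++ ((true :: (List.replicate U.length true ++ [true])) ++ b))) := by
        refine h1.congr rfl fun f => ?_
        simp only [agree_iff, fr_length]
        constructor
        · rintro ⟨_, hg, a, s, t, b, rfl, rfl, ha, hb, hsl, htl, -⟩
          exact ⟨a, t, b, rfl, ha, htl, hb, hT a s b ha hsl hg⟩
        · rintro ⟨a, s, b, rfl, ha, hsl, hb, hg⟩
          exact ⟨_, hg, a, _, s, b, rfl, rfl, ha, hb, by simp, hsl, fun k hk hPk => by
            simp only [fr, List.getElem_map] at hPk
            cases hPk⟩
      have split : ∀ f : List Bool, f.length = (lowWord p).length → ∃ a s b, f = a ++ (s ++ b) ∧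
          a.length = A.length ∧ s.length = (x :: (U ++ [y])).length ∧ b.length = B.length := by
        intro f hfl
        rw [hw'] at hfl
        simp only [List.length_append] at hfl
        exact ⟨f.take A.length, (f.drop A.length).take (x :: (U ++ [y])).length,
          (f.drop A.length).drop (x :: (U ++ [y])).length, by simp only [List.take_append_drop],
          by simp; omega, by simp at hfl ⊢; omega, by simp at hfl ⊢; omega⟩
      have h3 := ih _ (by
        rw [← hn]
        refine Set.ncard_lt_ncard ⟨?_, ?_⟩
          ((List.finite_length_eq Bool (lowWord p).length).subset fun f hf => hf.1)
        · rintro f ⟨hfl, hf'⟩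
          refine ⟨hfl, fun hFf => hf' ?_⟩
          obtain ⟨a, s, b, rfl, ha, hsl, hb⟩ := split f hfl
          exact ⟨a, s, b, rfl, ha, hsl, hb, hT a s b ha hsl hFf⟩
        · intro hsub
          have hmem := @hsub (List.replicate A.length true ++
            ((false :: (List.replicate U.length true ++ [true])) ++ List.replicate B.length true))
            ⟨by simp [hw'], fun hFf => by
              have := hfi _ hFf
              rw [List.getElem?_append_right (by simp; omega),
                List.getElem?_append_left (by simp; omega),
                List.getElem?_append_right (by simp; omega),
                List.getElem?_append_left (by simp; omega), List.length_replicate,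
                show i.1 - A.length = 0 by omega, show j.1 - A.length = U.length + 1 by omega]
                at this
              simp at this⟩
          refine hmem.2 ⟨_, _, _, rfl, by simp, by simp, by simp, ?_⟩
          convert h.const true using 1
          rw [List.eq_replicate_iff]
          simp [hw']) h2 rfl
      obtain ⟨V, hV⟩ := exists_csum_eq (-csum (x :: (U ++ [y])))
      have h4 := LMem.replace_segment hD (LMem.congr h3 hw' fun _ => Iff.rfl)
        ((hlink _ _ _ hl).lMem hD hs' hV) (sing_of_csum_eq_zero hD hs' (by rw [csum_append, hV]; simp))
      refine h4.congr hw'.symm fun f => ?_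
      constructor
      · rintro ⟨a, _, b, rfl, ha, hsl, hb, hFab, ξ, u, rfl⟩
        simp only [List.length_cons, List.length_append, List.length_nil] at hsl
        exact inner (by omega) (by simp; omega) (by omega) hFab
      · intro hFf
        obtain ⟨a, s, b, rfl, ha, hsl, hb⟩ := split f (h.length hFf)
        refine ⟨a, s, b, rfl, ha, hsl, hb, hT a s b ha hsl hFf, ?_⟩
        obtain ⟨ξ, s, rfl⟩ := List.exists_of_length_succ s hsl
        obtain ⟨u, η, rfl⟩ := (List.eq_nil_or_concat' s).resolve_left (by rintro rfl; simp at hsl)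
        have := hfi _ hFf
        simp only [List.length_cons, List.length_append, List.length_nil] at hsl
        rw [List.getElem?_append_right (by omega), List.getElem?_append_left (by simp; omega),
          List.getElem?_append_right (by omega), List.getElem?_append_left (by simp; omega),
          show i.1 - a.length = 0 by omega, show j.1 - a.length = u.length + 1 by omega] at this
        simp at this
        exact ⟨ξ, u, by simp [this]⟩
    · refine LMem.congr hsing rfl fun f => ?_
      rw [hF, sem_nil_iff_getElem? hk]
      simp only [lowWord, List.length_ofFn]
      refine ⟨fun hfl => ⟨hfl, fun i j hij => ?_⟩, fun h => h.1⟩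
      push Not at hex
      rcases lt_trichotomy i j with h3 | rfl | h3
      · exact (hex i j h3 hij).elim
      · rfl
      · exact (hex j i h3 (p.rel.symm hij)).elim

theorem subset_of_links (hC : IsCategory C) (hD : IsCategory D) (hs : singPair ∈ C)
    (hs' : singPair ∈ D) (hf : fourWBWB ∉ C) (hNC : ∀ p ∈ C, Noncrossing p)
    (hdeg : degreeSubgroup hC ≤ degreeSubgroup hD)
    (hlink : ∀ x y m, Link C x y m → Link D x y m) : C ⊆ D := by
  intro p hp
  have h := LMem.transfer hC hD hs hs' hf hNC hdeg hlink ((mem_iff_mem_sem.1 hp).bend hC)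
  refine mem_iff_mem_sem.2 ((h.unbend hD).congr rfl rfl fun a b => ?_)
  constructor
  · rintro ⟨ha, a', b', he, hab⟩
    obtain ⟨h1, rfl⟩ := List.append_inj he (by simp [ha, hab.length_up])
    rwa [List.reverse_injective h1]
  · exact fun hab => ⟨hab.length_up, a, b, rfl, hab⟩

end Inclusion

/-! ### The parameters of a category -/

section Parameters

variable {C : Set TCP}

theorem csum_ofFn {n : ℕ} (c : Fin n → Color) :
    csum (List.ofFn c) = Nat.card {j // c j = white} - Nat.card {j // c j = black} := by
  have h : ∀ x : Color, sgn x = (if x = white then 1 else 0) - (if x = black then 1 else 0) := by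
    decide
  simp only [csum, List.map_ofFn, List.sum_ofFn, Function.comp_apply, h, Finset.sum_sub_distrib,
    Nat.card_eq_fintype_card, Fintype.card_subtype, Finset.card_filter, Nat.cast_sum, Nat.cast_ite,
    Nat.cast_one, Nat.cast_zero]

theorem cval_eq (p : TCP) : cval p = csum (lowWord p) - csum (upWord p) := by
  rw [lowWord, upWord, csum_ofFn, csum_ofFn, cval]
  push_cast
  ring

theorem cval_mem_degreeSubgroup (hC : IsCategory C) (hs : singPair ∈ C) {p : TCP} (hp : p ∈ C) :
    cval p ∈ degreeSubgroup hC := by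
  have h := (sing_iff hC hs).1 (((mem_iff_mem_sem.1 hp).bend hC).sing hC hs)
  rw [csum_append, csum_winv] at h
  rwa [cval_eq, sub_eq_neg_add]

theorem exists_cval_eq_iff (hC : IsCategory C) (hs : singPair ∈ C) {n : ℤ} :
    (∃ p ∈ C, cval p = n) ↔ n ∈ degreeSubgroup hC := by
  constructor
  · rintro ⟨p, hp, rfl⟩
    exact cval_mem_degreeSubgroup hC hs hp
  · rintro ⟨w, rfl, p, hp, hu, rfl, -⟩
    exact ⟨p, hp, by simp [cval_eq, hu]⟩

theorem mem_iff_sInf_dvd (H : AddSubgroup ℤ) (m : ℤ) :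
    m ∈ H ↔ ((sInf {n : ℕ | 0 < n ∧ (n : ℤ) ∈ H} : ℕ) : ℤ) ∣ m := by
  rcases Set.eq_empty_or_nonempty {n : ℕ | 0 < n ∧ (n : ℤ) ∈ H} with hS | hS
  · rw [hS, Nat.sInf_empty, Nat.cast_zero, zero_dvd_iff]
    refine ⟨fun hm => ?_, fun hm => hm ▸ H.zero_mem⟩
    by_contra hne
    have : m.natAbs ∈ {n : ℕ | 0 < n ∧ (n : ℤ) ∈ H} := by
      refine ⟨Int.natAbs_pos.2 hne, ?_⟩
      rcases Int.natAbs_eq m with h | h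
      · rwa [← h]
      · rw [← neg_mem_iff, ← h]
        exact hm
    simp [hS] at this
  · have hmem := Nat.sInf_mem hS
    set d := sInf {n : ℕ | 0 < n ∧ (n : ℤ) ∈ H} with hd
    constructor
    · intro hm
      rw [Int.dvd_iff_emod_eq_zero]
      by_contra hne
      have h0 := Int.emod_nonneg m (b := d) (by have := hmem.1; omega)
      have h1 := Int.emod_lt_of_pos m (b := d) (by have := hmem.1; omega)
      have h2 : m % d ∈ H := by
        rw [Int.emod_def, mul_comm, ← smul_eq_mul]
        exact sub_mem hm (zsmul_mem hmem.2 _)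
      have h3 : (m % d).toNat ∈ {n : ℕ | 0 < n ∧ (n : ℤ) ∈ H} :=
        ⟨by omega, by rwa [Int.toNat_of_nonneg h0]⟩
      have h4 := Nat.sInf_le h3
      omega
    · rintro ⟨c, rfl⟩
      rw [mul_comm, ← smul_eq_mul]
      exact zsmul_mem hmem.2 _

theorem kdeg_dvd_iff (hC : IsCategory C) (hs : singPair ∈ C) {m : ℤ} :
    m ∈ degreeSubgroup hC ↔ (kdeg C : ℤ) ∣ m := by
  simp only [kdeg, exists_cval_eq_iff hC hs]
  exact mem_iff_sInf_dvd _ _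

theorem Link.congr (hC : IsCategory C) (hs : singPair ∈ C) {x y : Color} {m n : ℤ}
    (h : Link C x y m) (hn : n - m ∈ degreeSubgroup hC) : Link C x y n := by
  obtain ⟨W, hW⟩ := exists_csum_eq n
  obtain ⟨B, hB⟩ := exists_csum_eq (-n - sgn x - sgn y)
  exact ⟨[], W, B, hW, h.pMem hC hs (by rwa [hW])
    (by rw [hW, hB]; convert (degreeSubgroup hC).zero_mem using 1; simp; ring)⟩

theorem link_of_inNDF (hC : IsCategory C) (hs : singPair ∈ C) {x y : Color} {p₁ p₂ : TCP}
    (h : InNDF C x y p₁ p₂) : Link C y x (cval p₁) := by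
  obtain ⟨hp, -, hk₁, hk₂, -, hl, hx, hy, hr⟩ := h
  have hu : upWord p₁ = [] := List.eq_nil_of_length_eq_zero (by simp [upWord, hk₁])
  have hu₂ : upWord p₂ = [] := List.eq_nil_of_length_eq_zero (by simp [upWord, hk₂])
  obtain ⟨_, x', W, y', B, hw, h0, h1⟩ := exists_split (lowWord p₂) (i := 0) (j := p₂.l - 1)
    (by omega) (by simp [lowWord]; omega)
  obtain rfl := List.eq_nil_of_length_eq_zero h0
  have hB : B = [] := by
    have := congrArg List.length hw
    simp [lowWord] at this h1
    exact List.eq_nil_of_length_eq_zero (by omega)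
  subst hB
  have hx' : x' = x := by
    have h2 : (lowWord p₂)[0]? = some x := by simp [lowWord, hx]; omega
    simpa [hw] using h2
  have hy' : y' = y := by
    have h2 : (lowWord p₂)[p₂.l - 1]? = some y := by simp [lowWord, hy]; omega
    have h3 : p₂.l - 1 = W.length + 1 := by simp at h1; omega
    rw [h3, hw] at h2
    simpa using h2
  subst hx' hy'
  have hlink := link_of_rel hC hs hp (i := Fin.natAdd p₁.l ⟨0, by omega⟩)
    (j := Fin.natAdd p₁.l ⟨p₂.l - 1, by omega⟩) (A := lowWord p₁) (W := W) (B := [])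
    (x := x') (y := y') (show p₁.k + p₂.k = 0 by omega) (by
      change sumRel p₁.rel p₂.rel (splitPt p₁ p₂ _) (splitPt p₁ p₂ _)
      simp only [splitPt, finSumFinEquiv_symm_apply_natAdd, Sum.elim_inr]
      exact hr)
    (by simpa [lowWord_tensor] using hw) (by simp [lowWord])
    (by simp [lowWord] at h1 ⊢; omega)
  have hdeg := cval_mem_degreeSubgroup hC hs hp
  refine (hlink.symm hC hs).congr hC hs ?_
  convert hdeg using 1
  rw [cval_eq, cval_eq, upWord_tensor, lowWord_tensor, hu, hu₂, hw]
  simp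
  ring

/-- The partition given by a pattern. -/
def patPart (P : Pat) : TCP :=
  mkLower P.length (fun j => P[j].1) (fun j => if P[j].2 = true then 0 else j + 1)

theorem sem_patPart (P : Pat) (a b : List Bool) : sem (patPart P) a b ↔ a = [] ∧ psem P b := by
  rw [patPart, sem_mkLower_pattern (flag := fun j => P[j].2)]
  · simp
  · intro i j
    grind

theorem lowWord_patPart (P : Pat) : lowWord (patPart P) = cols P := by
  rw [patPart, lowWord_mkLower (flag := fun j => P[j].2)]
  simp

theorem exists_inNDF_of_link (hC : IsCategory C) (hs : singPair ∈ C)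
    (hNC : ∀ p ∈ C, Noncrossing p) {x y : Color} {n : ℤ} (h : Link C y x n) :
    ∃ p₁ p₂, InNDF C x y p₁ p₂ ∧ cval p₁ = n := by
  obtain ⟨A, hA⟩ := exists_csum_eq n
  obtain ⟨U, hU⟩ := exists_csum_eq (-n - sgn y - sgn x)
  have h1 := (h.symm hC hs).pMem hC hs (A := A ++ [white, black]) (W := U) (B := [])
    (by simp [hU]) (by
      convert (degreeSubgroup hC).zero_mem using 1
      simp [hU, hA, white, black, sgn]
      ring)
  have hmem : tensor (patPart (fr (A ++ [white, black])))
      (patPart ((x, true) :: (fr U ++ [(y, true)]))) ∈ C := by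
    refine mem_iff_mem_sem.2 (Mem.congr h1 ?_ ?_ fun a b => ?_)
    · rw [upWord_tensor]
      rfl
    · simp [lowWord_tensor, lowWord_patPart]
    · rw [sem_tensor]
      simp only [sem_patPart, psem_fr]
      constructor
      · rintro ⟨rfl, ξ, hb⟩
        obtain ⟨b₁, b₂, rfl, hb₁, hb₂⟩ := fits_append_iff.1 hb
        exact ⟨[], [], b₁, b₂, rfl, rfl, ⟨rfl, fits_fr.1 hb₁⟩, rfl, ξ, hb₂⟩
      · rintro ⟨_, _, b₁, b₂, rfl, rfl, ⟨rfl, hb₁⟩, rfl, ξ, hb₂⟩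
        exact ⟨rfl, ξ, fits_append_iff.2 ⟨b₁, b₂, rfl, fits_fr.2 hb₁, hb₂⟩⟩
  refine ⟨_, _, ⟨hmem, hNC _ hmem, rfl, rfl, ?_, ?_, ?_, ?_, ?_⟩, ?_⟩
  · simp [patPart, mkLower]
  · simp [patPart, mkLower]
  · simp [patPart, mkLower]
  · simp [patPart, mkLower]
  · exact show (_ : ℕ) = _ by simp [patPart, mkLower]
  · rw [cval_eq, lowWord_patPart]
    simp [hA, upWord, patPart, mkLower, white, black, sgn]

theorem mem_Kset_iff (hC : IsCategory C) (hs : singPair ∈ C) (hNC : ∀ p ∈ C, Noncrossing p)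
    {x y : Color} {n : ℤ} : n ∈ Kset C x y ↔ Link C y x n := by
  constructor
  · rintro ⟨p₁, p₂, h, rfl⟩
    exact link_of_inNDF hC hs h
  · exact exists_inNDF_of_link hC hs hNC

theorem ddeg_dvd_iff (hC : IsCategory C) (hs : singPair ∈ C) (hNC : ∀ p ∈ C, Noncrossing p)
    {m : ℤ} : m ∈ linkSubgroup hC hs ↔ (ddeg C : ℤ) ∣ m := by
  simp only [ddeg, mem_Kset_iff hC hs hNC, link_black_white hC hs]
  exact mem_iff_sInf_dvd _ _

end Parameters

/-! ### The generators -/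

section Generators

variable {C : Set TCP}

theorem tensorPow_singl_mem_iff (hC : IsCategory C) (hs : singPair ∈ C) {n : ℕ} :
    tensorPow (singl white) n ∈ C ↔ (n : ℤ) ∈ degreeSubgroup hC := by
  have hu : ∀ n, upWord (tensorPow (singl white) n) = [] := fun n => by
    induction n with
    | zero => rfl
    | succ n ih => rw [tensorPow, upWord_tensor, ih]; rfl
  have hl : ∀ n, lowWord (tensorPow (singl white) n) = List.replicate n white := fun n => by
    induction n with
    | zero => rfl
    | succ n ih => rw [tensorPow, lowWord_tensor, ih, List.replicate_succ']; rfl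
  have hsem : ∀ n a b, sem (tensorPow (singl white) n) a b ↔ a = [] ∧ b.length = n := fun n => by
    induction n with
    | zero =>
      intro a b
      rw [tensorPow, emptyPart, sem_mkLower]
      simp
    | succ n ih =>
      intro a b
      rw [tensorPow, sem_tensor]
      simp only [ih, sem_singl]
      constructor
      · rintro ⟨_, _, b₁, _, rfl, rfl, ⟨rfl, h⟩, rfl, x, rfl⟩
        simp [h]
      · rintro ⟨rfl, h⟩
        obtain ⟨b', x, rfl⟩ := List.eq_nil_or_concat' b |>.resolve_left (by rintro rfl; simp at h)
        exact ⟨[], [], b', [x], rfl, rfl, ⟨rfl, by simpa using h⟩, rfl, x, rfl⟩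
  have h : tensorPow (singl white) n ∈ C ↔ Sing C (List.replicate n white) := by
    rw [mem_iff_mem_sem, hu, hl]
    exact ⟨fun h => h.congr rfl rfl (by simpa using hsem n),
      fun h => Mem.congr h rfl rfl (by simpa [iff_comm] using hsem n)⟩
  rw [h, sing_iff hC hs]
  simp [sgn, white]

theorem pPart_mem_iff (hC : IsCategory C) (hs : singPair ∈ C) {d : ℕ} :
    pPart d ∈ C ↔ (d : ℤ) ∈ linkSubgroup hC hs := by
  have h : (List.ofFn fun j : Fin (2 * d + 2) =>
      (decide (j.1 ≤ d), decide (j.1 = d ∨ j.1 = 2 * d + 1))) =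
      fr (List.replicate d white) ++ ((white, true) :: (fr (List.replicate d black) ++
        ((black, true) :: fr []))) := by
    refine List.ext_getElem (by simp; omega) fun i h1 h2 => ?_
    simp only [fr, white, black, List.map_replicate, List.map_nil, List.getElem_ofFn,
      List.getElem_append, List.getElem_cons, List.getElem_replicate, List.length_replicate]
    simp only [List.length_ofFn] at h1
    split_ifs
    all_goals first | omega | (simp; omega)
  rw [pPart, mkLower_mem_iff (flag := fun j => decide (j.1 = d ∨ j.1 = 2 * d + 1)) _
    (fun i j => by grind), h, ← neg_mem_iff, mem_linkSubgroup]
  constructor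
  · exact fun h => ⟨_, _, _, by simp [black, sgn], h⟩
  · intro h
    refine h.pMem hC hs ?_ ?_
    · simp [black, sgn]
    · simp [white, black, sgn]

theorem pPrime_mem_iff (hC : IsCategory C) (hs : singPair ∈ C) {r : ℕ} :
    pPrime r ∈ C ↔ Link C white white (r - 1) := by
  have h : Link C white white (r - 1) ↔ Link C black black (1 - r) := by
    rw [link_black_black hC, neg_sub]
  rw [h, pPrime]
  split_ifs with hr
  · subst hr
    rw [mkLower_mem_iff (flag := ![false, true, false, true]) _ (by decide)]
    have he : (List.ofFn fun j : Fin 4 => ((![white, black, white, black] : Fin 4 → Color) j,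
        (![false, true, false, true] : Fin 4 → Bool) j)) =
        fr [white] ++ ((black, true) :: (fr [white] ++ ((black, true) :: fr []))) := rfl
    rw [he]
    constructor
    · exact fun h => ⟨_, _, _, by simp [white, sgn], h⟩
    · intro h
      refine h.pMem hC hs ?_ ?_
      · simp [white, sgn]
      · simp [white, black, sgn]
  · obtain ⟨s, rfl⟩ := Nat.exists_eq_succ_of_ne_zero hr
    have he : (List.ofFn fun j : Fin (2 * (s + 1) + 2) =>
        (decide (j.1 ≤ s + 1), decide (j.1 = s + 1 + 1 ∨ j.1 = 2 * (s + 1) + 1))) =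
        fr (List.replicate (s + 2) white) ++ ((black, true) :: (fr (List.replicate s black) ++
          ((black, true) :: fr []))) := by
      refine List.ext_getElem (by simp; omega) fun i h1 h2 => ?_
      simp only [fr, white, black, List.map_replicate, List.map_nil, List.getElem_ofFn,
        List.getElem_append, List.getElem_cons, List.getElem_replicate, List.length_replicate]
      simp only [List.length_ofFn] at h1
      split_ifs
      all_goals first | omega | (simp; omega)
    rw [mkLower_mem_iff (flag := fun j => decide (j.1 = s + 1 + 1 ∨ j.1 = 2 * (s + 1) + 1)) _
      (fun i j => by grind), he]
    constructor
    · exact fun h => ⟨_, _, _, by simp [black, sgn], h⟩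
    · intro h
      refine h.pMem hC hs ?_ ?_
      · simp [black, sgn]
      · convert (degreeSubgroup hC).zero_mem using 1
        simp [white, black, sgn]
        ring

theorem wwbb_mem_iff (hC : IsCategory C) (hs : singPair ∈ C) :
    wwbb ∈ C ↔ Link C white white 0 := by
  constructor
  · intro h
    refine link_of_rel hC hs h (i := (0 : Fin 4)) (j := (1 : Fin 4)) (A := []) (W := [])
      (B := [black, black]) rfl ?_ ?_ rfl rfl
    · exact show (_ : ℕ) = _ from rfl
    · rw [wwbb, lowWord_tensor]
      rfl
  · intro h
    have h1 : PMem C (fr [] ++ ((white, true) :: (fr [] ++ ((white, true) :: fr [black, black])))) :=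
      h.pMem hC hs (by simp) (by simp [white, black, sgn])
    have h2 : LMem C ([white, white] ++ ([black, black] ++ [])) (fun f => ∃ a s b,
        f = a ++ (s ++ b) ∧ a.length = [white, white].length ∧ s.length = [black, black].length ∧
        b.length = ([] : List Color).length ∧ ∃ x, a = [x, x]) := by
      refine LMem.congr h1 (by simp) fun f => ?_
      constructor
      · rintro ⟨ξ, hf⟩
        simp only [fr_nil, fr_cons, List.nil_append, fits_cons_iff, fits_nil] at hf
        obtain ⟨x, _, rfl, hx, y, _, rfl, hy, z, _, rfl, -, t, _, rfl, -, rfl⟩ := hf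
        obtain rfl := hx trivial
        obtain rfl := hy trivial
        exact ⟨[y, y], [z, t], [], by simp⟩
      · rintro ⟨_, s, b, rfl, -, hs, hb, x, rfl⟩
        obtain ⟨z, t, rfl⟩ := List.length_eq_two.1 hs
        obtain rfl := List.length_eq_zero_iff.1 hb
        exact ⟨x, by simp [fr]⟩
    have h3 : Link C black black (csum []) := (link_black_black hC).2 (by simpa using h)
    have h4 := LMem.replace_segment hC h2
      (h3.lMem hC hs (V := [white, white]) (by simp [white, black, sgn]))
      (sing_of_csum_eq_zero hC hs (by simp [white, black, sgn]))
    refine mem_iff_mem_sem.2 (Mem.congr h4 ?_ ?_ fun a b => ?_)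
    · rw [wwbb, upWord_tensor]
      rfl
    · rw [wwbb, lowWord_tensor]
      rfl
    · rw [wwbb, sem_tensor]
      simp only [sem_pairLower]
      constructor
      · rintro ⟨rfl, _, _, b, rfl, -, hs, hb, ⟨x, rfl⟩, y, u, rfl⟩
        obtain rfl := List.length_eq_zero_iff.1 hb
        obtain rfl : u = [] := List.length_eq_zero_iff.1 (by simpa using hs)
        exact ⟨[], [], [x, x], [y, y], by simp⟩
      · rintro ⟨_, _, _, _, rfl, rfl, ⟨rfl, x, rfl⟩, rfl, y, rfl⟩
        exact ⟨rfl, [x, x], [y, y], [], by simp, rfl, rfl, rfl, ⟨x, rfl⟩, y, [], rfl⟩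

end Generators

/-! ### Generated categories -/

section Generated

variable {C S : Set TCP}

theorem isCategory_generated (S : Set TCP) : IsCategory (generated S) where
  tensor_mem p hp q hq D hD hS := hD.tensor_mem p (hp D hD hS) q (hq D hD hS)
  comp_mem q hq p hp h hm D hD hS := hD.comp_mem q (hq D hD hS) p (hp D hD hS) h hm
  invol_mem p hp D hD hS := hD.invol_mem p (hp D hD hS)
  idw_mem _ hD _ := hD.idw_mem
  idb_mem _ hD _ := hD.idb_mem
  pairwb_mem _ hD _ := hD.pairwb_mem
  pairbw_mem _ hD _ := hD.pairbw_mem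

theorem subset_generated (S : Set TCP) : S ⊆ generated S := fun _ hp _ _ hS => hS hp

theorem eq_generated (hC : IsCategory C) (hs : singPair ∈ C) (hf : fourWBWB ∉ C)
    (hNC : ∀ p ∈ C, Noncrossing p) (hS : S ⊆ C) (hs' : singPair ∈ generated S)
    (hk : tensorPow (singl white) (kdeg C) ∈ S)
    (hd : (ddeg C : ℤ) ∈ linkSubgroup (isCategory_generated S) hs')
    (hww : (∀ m, ¬Link C white white m) ∨
      ∃ m, Link C white white m ∧ Link (generated S) white white m) :
    C = generated S := by
  have hD := isCategory_generated S
  have hdeg : degreeSubgroup hC ≤ degreeSubgroup hD := fun m hm => by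
    obtain ⟨n, rfl⟩ := (kdeg_dvd_iff hC hs).1 hm
    rw [mul_comm, ← smul_eq_mul]
    exact zsmul_mem ((tensorPow_singl_mem_iff hD hs').1 (subset_generated S hk)) n
  have hlinks : linkSubgroup hC hs ≤ linkSubgroup hD hs' := fun m hm => by
    obtain ⟨n, rfl⟩ := (ddeg_dvd_iff hC hs hNC).1 hm
    rw [mul_comm, ← smul_eq_mul]
    exact zsmul_mem hd n
  have hw : ∀ m, Link C white white m → Link (generated S) white white m := fun m hm => by
    rcases hww with h | ⟨n, h, h'⟩
    · exact absurd hm (h m)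
    · simpa using h'.white_white_add hD hs' (hlinks (hm.white_white_sub hC hs h))
  refine (subset_of_links hC hD hs hs' hf hNC hdeg ?_).antisymm fun p hp => hp C hC hS
  rintro (_ | _) (_ | _) m h
  · exact (link_black_black hD).2 (hw _ ((link_black_black hC).1 h))
  · exact (link_black_white hD hs').2 (hlinks ((link_black_white hC hs).1 h))
  · exact hlinks h
  · exact hw m h

theorem kdeg_mem (hC : IsCategory C) (hs : singPair ∈ C) :
    tensorPow (singl white) (kdeg C) ∈ C :=
  (tensorPow_singl_mem_iff hC hs).2 ((kdeg_dvd_iff hC hs).2 dvd_rfl)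

theorem ddeg_dvd_kdeg (hC : IsCategory C) (hs : singPair ∈ C) (hNC : ∀ p ∈ C, Noncrossing p) :
    ddeg C ∣ kdeg C := by
  have h := degreeSubgroup_le_linkSubgroup hC hs ((kdeg_dvd_iff hC hs).2 dvd_rfl)
  exact Int.natCast_dvd_natCast.1 ((ddeg_dvd_iff hC hs hNC).1 h)

/-- The set of which `rdeg` takes the minimum is nonempty as soon as `C` has links with end
points of equal color. -/
theorem exists_one_le_mem_Kset (hC : IsCategory C) (hs : singPair ∈ C)
    (hNC : ∀ p ∈ C, Noncrossing p) (hK : Kset C black black ≠ ∅) :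
    {t : ℕ | 1 ≤ t ∧ (t : ℤ) ∈ Kset C black black}.Nonempty := by
  obtain ⟨n, hn⟩ := Set.nonempty_iff_ne_empty.2 hK
  rw [mem_Kset_iff hC hs hNC, link_black_black hC] at hn
  have key : ∃ t : ℤ, 1 ≤ t ∧ Link C white white (-t) := by
    by_cases h1 : 1 ≤ n
    · exact ⟨n, h1, hn⟩
    · exact ⟨2 - n, by omega, by convert hn.white_white_symm hC hs using 1; ring⟩
  obtain ⟨t, ht, h⟩ := key
  lift t to ℕ using by omega
  exact ⟨t, by exact_mod_cast ht, (mem_Kset_iff hC hs hNC).2 ((link_black_black hC).2 h)⟩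

theorem link_rdeg (hC : IsCategory C) (hs : singPair ∈ C)
    (hNC : ∀ p ∈ C, Noncrossing p) (hK : Kset C black black ≠ ∅) :
    Link C white white (rdeg C - 1) := by
  have h := Nat.sInf_mem (exists_one_le_mem_Kset hC hs hNC hK)
  rw [Set.mem_ofPred_eq, mem_Kset_iff hC hs hNC, link_black_black hC] at h
  convert h.2.white_white_symm hC hs using 1
  rw [rdeg, Nat.cast_sub h.1]
  ring

theorem ddeg_dvd_two_mul_rdeg (hC : IsCategory C) (hs : singPair ∈ C)
    (hNC : ∀ p ∈ C, Noncrossing p) (hK : Kset C black black ≠ ∅) :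
    ddeg C ∣ 2 * rdeg C := by
  have h := link_rdeg hC hs hNC hK
  have h1 := (ddeg_dvd_iff hC hs hNC).1 (h.white_white_sub hC hs (h.white_white_symm hC hs))
  rw [← Int.natCast_dvd_natCast]
  convert h1 using 1
  push_cast
  ring

theorem rdeg_lt_ddeg (hC : IsCategory C) (hs : singPair ∈ C)
    (hNC : ∀ p ∈ C, Noncrossing p) (hK : Kset C black black ≠ ∅) (hd : ddeg C ≠ 0) :
    rdeg C < ddeg C := by
  by_contra! hlt
  have h : Link C white white (-(rdeg C + 1)) := by
    convert (link_rdeg hC hs hNC hK).white_white_symm hC hs using 1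
    ring
  have h1 := h.white_white_add hC hs ((ddeg_dvd_iff hC hs hNC).2 dvd_rfl)
  have h2 : rdeg C + 1 - ddeg C ∈ {t : ℕ | 1 ≤ t ∧ (t : ℤ) ∈ Kset C black black} := by
    refine ⟨by omega, (mem_Kset_iff hC hs hNC).2 ((link_black_black hC).2 ?_)⟩
    convert h1 using 1
    push_cast [show ddeg C ≤ rdeg C + 1 by omega]
    ring
  have h3 := Nat.sInf_le h2
  have h4 : rdeg C = sInf {t : ℕ | 1 ≤ t ∧ (t : ℤ) ∈ Kset C black black} - 1 := rfl
  omega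

theorem rdeg_eq_zero_or (hC : IsCategory C) (hs : singPair ∈ C)
    (hNC : ∀ p ∈ C, Noncrossing p) (hK : Kset C black black ≠ ∅) :
    rdeg C = 0 ∨ 2 * rdeg C = ddeg C := by
  obtain ⟨n, hn⟩ := ddeg_dvd_two_mul_rdeg hC hs hNC hK
  rcases eq_or_ne (ddeg C) 0 with hd | hd
  · rw [hd] at hn
    omega
  · have hlt := rdeg_lt_ddeg hC hs hNC hK hd
    have hn2 : n < 2 := by
      by_contra! h
      have := Nat.mul_le_mul_left (ddeg C) h
      omega
    interval_cases n <;> omega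

end Generated

/-- Classification in case B. -/
theorem stmt_17 (C : Set TCP) (hC : IsCategory C) (hNC : ∀ p ∈ C, Noncrossing p)
    (hB : CaseB C) :
    (GloballyColorized C → ddeg C = 2 → Even (kdeg C) ∧
        C = generated {tensorPow (singl white) (kdeg C), singPair, wwbb}) ∧
    (GloballyColorized C → ddeg C = 1 →
        C = generated {tensorPow (singl white) (kdeg C), pPart 1, singPair, wwbb}) ∧
    (¬GloballyColorized C → Kset C black black = ∅ →
        C = generated {tensorPow (singl white) (kdeg C), pPart (ddeg C), singPair}) ∧
    (¬GloballyColorized C → Kset C black black ≠ ∅ →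
        kdeg C ≠ 1 ∧ ddeg C ≠ 1 ∧ (rdeg C = 0 ∨ 2 * rdeg C = ddeg C) ∧ rdeg C ≠ 1 ∧
        C = generated {tensorPow (singl white) (kdeg C), pPart (ddeg C),
          pPrime (rdeg C), singPair}) := by
  obtain ⟨hs, hf⟩ := hB
  have hk := kdeg_mem hC hs
  have hdvd := ddeg_dvd_kdeg hC hs hNC
  have hp : pPart (ddeg C) ∈ C := (pPart_mem_iff hC hs).2 ((ddeg_dvd_iff hC hs hNC).2 dvd_rfl)
  refine ⟨fun hg hd => ⟨even_iff_two_dvd.2 (hd ▸ hdvd), ?_⟩, fun hg hd => ?_, fun _ hK => ?_,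
    fun hl hK => ?_⟩
  · have hs' := subset_generated {tensorPow (singl white) (kdeg C), singPair, wwbb}
      (show singPair ∈ _ by simp)
    have hw := (wwbb_mem_iff (isCategory_generated _) hs').1
      (subset_generated _ (show wwbb ∈ _ by simp))
    refine eq_generated hC hs hf hNC ?_ hs' (by simp) ?_ (Or.inr ⟨0, (wwbb_mem_iff hC hs).1 hg, hw⟩)
    · rintro p (rfl | rfl | rfl) <;> assumption
    · rw [hd]
      exact hw.white_white_sub _ hs' (hw.white_white_symm (isCategory_generated _) hs')
  · have hs' := subset_generated {tensorPow (singl white) (kdeg C), pPart 1, singPair, wwbb}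
      (show singPair ∈ _ by simp)
    have hw := (wwbb_mem_iff (isCategory_generated _) hs').1
      (subset_generated _ (show wwbb ∈ _ by simp))
    rw [hd] at hp
    refine eq_generated hC hs hf hNC ?_ hs' (by simp) ?_ (Or.inr ⟨0, (wwbb_mem_iff hC hs).1 hg, hw⟩)
    · rintro p (rfl | rfl | rfl | rfl) <;> assumption
    · rw [hd]
      exact (pPart_mem_iff _ hs').1 (subset_generated _ (by simp))
  · have hs' := subset_generated {tensorPow (singl white) (kdeg C), pPart (ddeg C), singPair}
      (show singPair ∈ _ by simp)
    refine eq_generated hC hs hf hNC ?_ hs' (by simp) ?_ (Or.inl fun m hm => ?_)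
    · rintro p (rfl | rfl | rfl) <;> assumption
    · exact (pPart_mem_iff _ hs').1 (subset_generated _ (by simp))
    · exact Set.eq_empty_iff_forall_notMem.1 hK (-m)
        ((mem_Kset_iff hC hs hNC).2 ((link_black_black hC).2 (by simpa using hm)))
  · have hr := link_rdeg hC hs hNC hK
    have h0 : ¬Link C white white 0 := fun h => hl ((wwbb_mem_iff hC hs).2 h)
    have hd1 : ddeg C ≠ 1 := fun hd => h0 <| by
      simpa using hr.white_white_add hC hs (n := 1 - rdeg C)
        ((ddeg_dvd_iff hC hs hNC).2 (by simp [hd]))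
    refine ⟨fun h => hd1 (Nat.dvd_one.1 (h ▸ hdvd)), hd1, rdeg_eq_zero_or hC hs hNC hK,
      fun h => h0 (by simpa [h] using hr), ?_⟩
    have hr' := (pPrime_mem_iff hC hs).2 hr
    have hs' := subset_generated {tensorPow (singl white) (kdeg C), pPart (ddeg C),
      pPrime (rdeg C), singPair} (show singPair ∈ _ by simp)
    refine eq_generated hC hs hf hNC ?_ hs' (by simp) ?_ (Or.inr ⟨_, hr, ?_⟩)
    · rintro p (rfl | rfl | rfl | rfl) <;> assumption
    · exact (pPart_mem_iff _ hs').1 (subset_generated _ (by simp))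
    · exact (pPrime_mem_iff (isCategory_generated _) hs').1 (subset_generated _ (by simp))

end CTCP
end
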